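/- arXiv:math/0208172 — 2 statements merged into one kernel-verified Lean document; each statement's English description precedes it below -/
import Mathlib

section
/- Let A be a commutative local algebra of finite rank over a field k with edim A ≤ 2. If Ext^1_A(Hom_k(A,k), A) = 0, then A is selfinjective. -/
open CategoryTheory

noncomputable section

/-- The module structure `(x • φ) y = φ (x * y)` on `Hom_k(A, k)` for a commutative
`k`-algebra `A`. -/
instance dualModule (k A : Type) [CommRing k] [CommRing A] [Algebra k A] :
    Module A (A →ₗ[k] k) where
  smul a f := f ∘ₗ LinearMap.mulLeft k a
  one_smul f := by
    ext x
    show f (1 * x) = f x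
    rw [one_mul]
  mul_smul a b f := by
    ext x
    show f ((a * b) * x) = f (b * (a * x))
    congr 1; ring
  smul_zero a := by ext x; rfl
  smul_add a f g := by ext x; rfl
  add_smul a b f := by
    ext x
    show f ((a + b) * x) = f (a * x) + f (b * x)
    rw [add_mul, map_add]
  zero_smul f := by
    ext x
    show f (0 * x) = 0
    rw [zero_mul, map_zero]

/-- The embedding dimension of a local ring: the minimal number of generators of the
maximal ideal. -/
def embDim (A : Type) [CommRing A] [IsLocalRing A] : ℕ∞ :=
  sInf { n : ℕ∞ | ∃ s : Finset A, (s.card : ℕ∞) = n ∧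
    Ideal.span (s : Set A) = IsLocalRing.maximalIdeal A }

/-- Vanishing of `Ext¹` in terms of a projective resolution: a map `P₁ ⟶ Y` killing the boundary
extends along `P₁ ⟶ P₀`. -/
lemma exists_comp_eq_of_isZero_ext_one {A : Type} [CommRing A] {X Y : ModuleCat.{0} A}
    (P : ProjectiveResolution X)
    (h : Limits.IsZero (((Ext A (ModuleCat A) 1).obj (Opposite.op X)).obj Y))
    (φ : P.complex.X 1 ⟶ Y) (hφ : P.complex.d 2 1 ≫ φ = 0) :
    ∃ ψ : P.complex.X 0 ⟶ Y, P.complex.d 1 0 ≫ ψ = φ := by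
  have h1 := h.of_iso (P.isoExt (R := A) 1 Y).symm
  rw [← HomologicalComplex.exactAt_iff_isZero_homology,
    HomologicalComplex.exactAt_iff' _ 0 1 2 (by simp) (by simp),
    ShortComplex.moduleCat_exact_iff] at h1
  obtain ⟨ψ, hψ⟩ := h1 φ hφ
  exact ⟨ψ, hψ⟩

/-- If `Ext¹(X, Y) = 0`, then maps to `Y` from the kernel of a projective cover of `X` extend. -/
lemma exists_extension_of_isZero_ext_one {A : Type} [CommRing A] {X Y : Type} [AddCommGroup X]
    [AddCommGroup Y] [Module A X] [Module A Y]
    (h : Limits.IsZero (((Ext A (ModuleCat A) 1).obj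
      (Opposite.op (ModuleCat.of A X))).obj (ModuleCat.of A Y)))
    {F : Type} [AddCommGroup F] [Module A F] [Module.Projective A F] (π : F →ₗ[A] X)
    (hπ : Function.Surjective π) (l : LinearMap.ker π →ₗ[A] Y) :
    ∃ κ : F →ₗ[A] Y, ∀ v : LinearMap.ker π, κ v = l v := by
  obtain ⟨P⟩ := HasProjectiveResolution.out (Z := ModuleCat.of A X)
  set P0 := P.complex.X 0
  have : Module.Projective A P0 :=
    (IsProjective.iff_projective P0).2 (inferInstanceAs (Projective (P.complex.X 0)))
  let ε : P0 →ₗ[A] X := (P.π.f 0).hom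
  have hε : Function.Surjective ε :=
    (ModuleCat.epi_iff_surjective _).1 (inferInstanceAs (Epi (P.π.f 0)))
  let d : P.complex.X 1 →ₗ[A] P0 := (P.complex.d 1 0).hom
  have hεd : ∀ p, ε (d p) = 0 := fun p ↦
    LinearMap.congr_fun (congrArg ModuleCat.Hom.hom P.complex_d_comp_π_f_zero) p
  have hexact : ∀ q, ε q = 0 → ∃ p, d p = q := by
    have := P.exact₀
    rw [ShortComplex.moduleCat_exact_iff] at this
    exact this
  obtain ⟨f, hf⟩ := Module.projective_lifting_property π ε hπ
  obtain ⟨g, hg⟩ := Module.projective_lifting_property ε π hε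
  replace hf : ∀ q, π (f q) = ε q := LinearMap.congr_fun hf
  replace hg : ∀ v, ε (g v) = π v := LinearMap.congr_fun hg
  let fd : P.complex.X 1 →ₗ[A] LinearMap.ker π :=
    (f ∘ₗ d).codRestrict _ fun p ↦ by simp [hf, hεd]
  obtain ⟨ψ, hψ⟩ := exists_comp_eq_of_isZero_ext_one P h (ModuleCat.ofHom (l ∘ₗ fd)) (by
    ext p
    have hz : d ((P.complex.d 2 1).hom p) = 0 :=
      LinearMap.congr_fun (congrArg ModuleCat.Hom.hom (P.complex.d_comp_d 2 1 0)) p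
    have : fd ((P.complex.d 2 1).hom p) = 0 := by
      ext
      simp [fd, hz]
    simpa using congrArg l this)
  replace hψ : ∀ p, ψ.hom (d p) = l (fd p) :=
    LinearMap.congr_fun (congrArg ModuleCat.Hom.hom hψ)
  let r : F →ₗ[A] LinearMap.ker π :=
    (LinearMap.id - f ∘ₗ g).codRestrict _ fun v ↦ by simp [hf, hg]
  refine ⟨ψ.hom ∘ₗ g + l ∘ₗ r, fun v ↦ ?_⟩
  obtain ⟨p, hp⟩ := hexact (g v) (by rw [hg]; exact v.2)
  have : fd p + r v = v := by
    ext
    simp [fd, r, hp]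
  change ψ.hom (g v) + l (r v) = l v
  rw [← hp, hψ, ← map_add, this]

open Polynomial in
/-- A finite-dimensional `k[X]`-module on which `X` is nilpotent is cyclic over `k[X][N]` for some
`k[X]`-linear endomorphism `N`. -/
lemma exists_endomorphism_cyclic {k : Type*} [Field k] (n : ℕ) :
    ∀ (E : Type*) [AddCommGroup E] [Module k E] [Module k[X] E] [IsScalarTower k k[X] E]
      [FiniteDimensional k E], Module.finrank k E ≤ n → ∀ m : ℕ, (∀ w : E, (X ^ m : k[X]) • w = 0) →
      ∃ (N : E →ₗ[k[X]] E) (d : E), ∀ w, ∃ q : k[X][X], aeval N q d = w := by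
  induction n with
  | zero =>
    intro E _ _ _ _ _ hn m _
    have : Subsingleton E := Module.finrank_zero_iff.1 (Nat.le_zero.1 hn)
    exact ⟨0, 0, fun w ↦ ⟨0, Subsingleton.elim _ _⟩⟩
  | succ n ih =>
    intro E _ _ _ _ _ hn m
    induction m with
    | zero =>
      intro hm
      exact ⟨0, 0, fun w ↦ ⟨0, by simpa using (hm w).symm⟩⟩
    | succ m ihm =>
      intro hm
      by_cases hm' : ∀ w : E, (X ^ m : k[X]) • w = 0
      · exact ihm hm'
      push Not at hm'
      obtain ⟨v, hv⟩ := hm'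
      obtain ⟨φ, hφ⟩ : ∃ φ : Module.Dual k E, φ ((X ^ m : k[X]) • v) = 1 := by
        have := (Module.forall_dual_apply_eq_zero_iff k ((X ^ m : k[X]) • v)).not.2 hv
        push Not at this
        obtain ⟨φ, hφ⟩ := this
        exact ⟨(φ ((X ^ m : k[X]) • v))⁻¹ • φ, by simp [hφ]⟩
      let E' : Submodule k[X] E :=
        { carrier := {w | ∀ p : k[X], φ (p • w) = 0}
          add_mem' := fun ha hb p ↦ by rw [smul_add, map_add, ha, hb, add_zero]
          zero_mem' := fun p ↦ by simp
          smul_mem' := fun c w hw p ↦ by rw [smul_smul]; exact hw _ }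
      have hmem : ∀ w : E, (∀ i, φ ((X ^ i : k[X]) • w) = 0) → w ∈ E' := by
        intro w hw p
        induction p using Polynomial.induction_on' with
        | add p q hp hq => rw [add_smul, map_add, hp, hq, add_zero]
        | monomial i a => rw [← smul_X_eq_monomial, smul_assoc, map_smul, hw, smul_zero]
      have hzero : ∀ i, m < i → ∀ w : E, (X ^ i : k[X]) • w = 0 := by
        intro i hi w
        obtain ⟨j, rfl⟩ := Nat.exists_eq_add_of_le' (Nat.succ_le_of_lt hi)
        rw [pow_add, mul_smul, hm, smul_zero]
      have hdvd : ∀ r : k[X], r • v ∈ E' → (X ^ (m + 1) : k[X]) ∣ r := by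
        intro r hr
        by_contra hnd
        have hr0 : r ≠ 0 := by rintro rfl; simp at hnd
        obtain ⟨q, hq, hXq⟩ := exists_eq_pow_rootMultiplicity_mul_and_not_dvd r hr0 0
        rw [C_0, sub_zero] at hq hXq
        set i := rootMultiplicity 0 r
        have hi : i ≤ m := by
          by_contra hi
          exact hnd (hq ▸ (pow_dvd_pow X (by omega)).mul_right q)
        have hcop : IsCoprime q (X ^ (m + 1)) :=
          (((irreducible_X.coprime_iff_not_dvd).2 hXq).symm).pow_right
        obtain ⟨a, b, hab⟩ := hcop
        have h1 : (X ^ (m - i) * a) • r • v = (X ^ m : k[X]) • v := by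
          rw [smul_smul]
          have : X ^ (m - i) * a * r = X ^ m - X ^ m * b * X ^ (m + 1) := by
            calc X ^ (m - i) * a * r = X ^ (m - i) * X ^ i * (a * q) := by rw [hq]; ring
              _ = X ^ m * (a * q) := by rw [← pow_add, Nat.sub_add_cancel hi]
              _ = X ^ m - X ^ m * b * X ^ (m + 1) := by rw [eq_sub_of_add_eq hab]; ring
          rw [this, sub_smul, mul_smul (X ^ m * b), hm, smul_zero, sub_zero]
        have h2 := hr (X ^ (m - i) * a)
        rw [h1, hφ] at h2
        exact one_ne_zero h2
      have hsum : ∀ w : E, ∀ j, ∃ c : k[X], ∀ i, m + 1 ≤ i + j →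
          φ ((X ^ i : k[X]) • (w - c • v)) = 0 := by
        intro w j
        induction j with
        | zero => exact ⟨0, fun i hi ↦ by rw [hzero i (by omega), map_zero]⟩
        | succ j ihj =>
          obtain ⟨c, hc⟩ := ihj
          by_cases hj : m < j
          · exact ⟨c, fun i _ ↦ hc i (by omega)⟩
          refine ⟨c + φ ((X ^ (m - j) : k[X]) • (w - c • v)) • X ^ j, fun i hi ↦ ?_⟩
          rw [add_smul, ← sub_sub, smul_sub, map_sub, smul_assoc, smul_comm (X ^ i : k[X]),
            φ.map_smul (φ ((X ^ (m - j) : k[X]) • (w - c • v))), smul_smul, ← pow_add]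
          rcases Nat.lt_or_ge m (i + j) with hij | hij
          · rw [hc i hij, hzero _ hij, map_zero, smul_zero, sub_zero]
          · obtain rfl : i = m - j := by omega
            rw [Nat.sub_add_cancel (by omega), hφ, smul_eq_mul, mul_one, sub_self]
      have hdecomp : ∀ w : E, ∃ c : k[X], w - c • v ∈ E' := fun w ↦ by
        obtain ⟨c, hc⟩ := hsum w (m + 1)
        exact ⟨c, hmem _ fun i ↦ hc i (by omega)⟩
      have hvE' : v ∉ E' := fun h ↦ one_ne_zero (hφ.symm.trans (h (X ^ m)))
      have : FiniteDimensional k E' :=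
        inferInstanceAs (FiniteDimensional k (E'.restrictScalars k))
      have hlt : Module.finrank k E' < Module.finrank k E :=
        Submodule.finrank_lt (s := E'.restrictScalars k) fun h ↦ hvE' (by
          have hv : v ∈ E'.restrictScalars k := h ▸ Submodule.mem_top
          exact hv)
      obtain ⟨N', d', hN'⟩ := ih E' (by omega) (m + 1) fun w ↦ Subtype.ext (hm w)
      let π : k[X] × E' →ₗ[k[X]] E :=
        (LinearMap.toSpanSingleton k[X] E v).coprod E'.subtype
      let G : k[X] × E' →ₗ[k[X]] E :=
        (LinearMap.toSpanSingleton k[X] E d').coprod (E'.subtype ∘ₗ N')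
      have hπ : Function.Surjective π := fun w ↦ by
        obtain ⟨c, hc⟩ := hdecomp w
        exact ⟨(c, ⟨_, hc⟩), by simp [π]⟩
      have hker : LinearMap.ker π ≤ LinearMap.ker G := by
        rintro ⟨r, e⟩ h
        have h : r • v + (e : E) = 0 := by simpa [π] using h
        obtain ⟨q, rfl⟩ := hdvd r (by rw [eq_neg_of_add_eq_zero_left h]; exact E'.neg_mem e.2)
        have hkill : ∀ w : E, (X ^ (m + 1) * q) • w = 0 := fun w ↦ by rw [mul_smul, hm]
        rw [hkill, zero_add] at h
        have he : e = 0 := Subtype.ext h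
        simp [G, he, hkill]
      let N : E →ₗ[k[X]] E :=
        (LinearMap.ker π).liftQ G hker ∘ₗ (π.quotKerEquivOfSurjective hπ).symm
      have hNπ : ∀ z, N (π z) = G z := by
        intro z
        have : (π.quotKerEquivOfSurjective hπ).symm (π z) = (LinearMap.ker π).mkQ z := by
          rw [LinearEquiv.symm_apply_eq]; rfl
        simp only [N, LinearMap.comp_apply, LinearEquiv.coe_coe, this]
        rfl
      have hNv : N v = d' := by simpa [π, G] using hNπ (1, 0)
      have hNE' : ∀ e : E', N e = N' e := fun e ↦ by simpa [π, G] using hNπ (0, e)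
      have hpoly : ∀ (q : k[X][X]) (e : E'), aeval N q (e : E) = aeval N' q e := by
        intro q
        induction q using Polynomial.induction_on with
        | C a => intro e; simp
        | add p q hp hq => intro e; simp [hp, hq]
        | monomial i a h =>
          intro e
          rw [pow_succ, ← mul_assoc, map_mul (aeval N) (C a * X ^ i),
            map_mul (aeval N') (C a * X ^ i), aeval_X, aeval_X, Module.End.mul_apply,
            Module.End.mul_apply, hNE', h]
      refine ⟨N, v, fun w ↦ ?_⟩
      obtain ⟨c, hc⟩ := hdecomp w
      obtain ⟨q, hq⟩ := hN' ⟨_, hc⟩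
      refine ⟨C c + q * X, ?_⟩
      rw [map_add, map_mul, aeval_X, aeval_C, LinearMap.add_apply, Module.End.mul_apply, hNv, hpoly,
        hq]
      simp

open Polynomial in
/-- For a nilpotent endomorphism `y` of a finite-dimensional space `D` there are an endomorphism `N`
commuting with `y` and a vector generating `D` under `y` and `N`. -/
lemma exists_commuting_endomorphism_cyclic {k D : Type*} [Field k] [AddCommGroup D] [Module k D]
    [FiniteDimensional k D] (y : Module.End k D) (hy : IsNilpotent y) :
    ∃ (N : Module.End k D) (d : D), Commute N y ∧ ∀ S : Submodule k D, d ∈ S →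
      (∀ v ∈ S, N v ∈ S) → (∀ v ∈ S, y v ∈ S) → S = ⊤ := by
  obtain ⟨m, hm⟩ := hy
  let E := Module.AEval' y
  have : FiniteDimensional k E := inferInstanceAs (FiniteDimensional k D)
  let e : D ≃ₗ[k] E := Module.AEval'.of y
  have he : ∀ v, (X : k[X]) • e v = e (y v) := Module.AEval'.X_smul_of y
  have hpow : ∀ i v, (X ^ i : k[X]) • e v = e ((y ^ i) v) :=
    fun i v ↦ Module.AEval'.X_pow_smul_of y v i
  obtain ⟨N, d, hN⟩ := exists_endomorphism_cyclic _ E le_rfl m fun w ↦ by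
    obtain ⟨w, rfl⟩ := e.surjective w
    rw [hpow, hm, LinearMap.zero_apply, map_zero]
  let N' : Module.End k D := e.symm ∘ₗ N.restrictScalars k ∘ₗ e
  have hN' : ∀ v, e (N' v) = N (e v) := fun v ↦ by simp [N']
  refine ⟨N', e.symm d, ?_, fun S hd hSN hSy ↦ eq_top_iff.2 fun w _ ↦ ?_⟩
  · ext v
    apply e.injective
    simp only [Module.End.mul_apply]
    rw [hN', ← he, map_smul, ← he, hN']
  · have hSX : ∀ (p : k[X]) v, v ∈ S → e.symm (p • e v) ∈ S := by
      intro p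
      induction p using Polynomial.induction_on' with
      | add p q hp hq =>
        intro v hv
        rw [add_smul, map_add]
        exact S.add_mem (hp v hv) (hq v hv)
      | monomial i a =>
        intro v hv
        rw [← smul_X_eq_monomial, smul_assoc, map_smul, hpow, e.symm_apply_apply]
        refine S.smul_mem _ ?_
        induction i with
        | zero => exact hv
        | succ i ih => rw [pow_succ']; exact hSy _ ih
    have hSq : ∀ (q : k[X][X]) v, v ∈ S → e.symm (aeval N q (e v)) ∈ S := by
      intro q
      induction q using Polynomial.induction_on with
      | C a => intro v hv; simpa using hSX a v hv
      | add p q hp hq =>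
        intro v hv
        rw [map_add, LinearMap.add_apply, map_add]
        exact S.add_mem (hp v hv) (hq v hv)
      | monomial i a h =>
        intro v hv
        rw [pow_succ, ← mul_assoc, map_mul (aeval N) (C a * X ^ i), aeval_X, Module.End.mul_apply,
          ← hN']
        exact h _ (hSN v hv)
    obtain ⟨q, hq⟩ := hN (e w)
    have := hSq q (e.symm d) hd
    rwa [e.apply_symm_apply, hq, e.symm_apply_apply] at this

/-- Let `B` deform `A` and `W` deform `D` along a central parameter `t`, and let `w` generate
`W`. If maps to `A` from the syzygies of `D` extend, then the values of `u : D → A` on the reductions of `w`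
lift to `B` compatibly with the syzygies of `W` modulo `t ^ (m + 1)`. -/
lemma exists_lift_generators {A B D W J : Type} [CommRing A] [Ring B] [AddCommGroup D] [Module A D]
    [AddCommGroup W] [Module B W] [Fintype J] {t : B} (ht : ∀ β, Commute t β)
    (htB : ∀ β : B, t * β = 0 → β = 0) (htW : ∀ w : W, t • w = 0 → w = 0)
    (ρ : B →+* A) (hρ : Function.Surjective ρ) (hker : ∀ β, ρ β = 0 → ∃ β', β = t * β')
    (hρt : ρ t = 0)
    (red : W →+ D) (hred : ∀ (β : B) w, red (β • w) = ρ β • red w)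
    (hredker : ∀ w, red w = 0 → ∃ w', w = t • w')
    (w : J → W) (hw : ∀ v, ∃ c : J → B, v = ∑ j, c j • w j)
    (hH : ∀ l : LinearMap.ker (Fintype.linearCombination A (fun j ↦ red (w j))) →ₗ[A] A,
      ∃ κ : (J → A) →ₗ[A] A, ∀ v : LinearMap.ker _, κ v = l v)
    (u : D →ₗ[A] A) (m : ℕ) :
    ∃ σ : J → B, (∀ j, ρ (σ j) = u (red (w j))) ∧
      ∀ β : J → B, ∑ j, β j • w j = 0 → ∃ c, ∑ j, β j * σ j = t ^ (m + 1) * c := by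
  classical
  have htpow : ∀ n (β : B), t ^ n * β = 0 → β = 0 := by
    intro n
    induction n with
    | zero => simp
    | succ n ih => intro β h; rw [pow_succ', mul_assoc] at h; exact ih _ (htB _ h)
  induction m with
  | zero =>
    choose σ hσ using fun j ↦ hρ (u (red (w j)))
    refine ⟨σ, hσ, fun β hβ ↦ ?_⟩
    rw [zero_add, pow_one]
    refine hker _ ?_
    have h := congrArg (fun v ↦ u (red v)) hβ
    simpa [map_sum, hred, hσ] using h
  | succ m ih =>
    obtain ⟨σ, hσ, hσm⟩ := ih
    have hlift : ∀ a : J → A, ∑ j, a j • red (w j) = 0 →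
        ∃ β : J → B, (∀ j, ρ (β j) = a j) ∧ ∑ j, β j • w j = 0 := by
      intro a ha
      choose β hβ using fun j ↦ hρ (a j)
      obtain ⟨w', hw'⟩ := hredker (∑ j, β j • w j) (by simpa [map_sum, hred, hβ] using ha)
      obtain ⟨c, rfl⟩ := hw w'
      refine ⟨fun j ↦ β j - t * c j, fun j ↦ by simp [hβ, hρt], ?_⟩
      simp [sub_smul, mul_smul, ← Finset.smul_sum, hw']
    have hwd : ∀ β : J → B, (∀ j, ρ (β j) = 0) → ∑ j, β j • w j = 0 → ∀ c,
        ∑ j, β j * σ j = t ^ (m + 1) * c → ρ c = 0 := by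
      intro β hβ hβw c hc
      choose β' hβ' using fun j ↦ hker _ (hβ j)
      obtain ⟨c', hc'⟩ := hσm β' (htW _ (by rw [← hβw]; simp [Finset.smul_sum, hβ', mul_smul]))
      have : t ^ (m + 1) * (c - t * c') = 0 := by
        rw [mul_sub, ← hc, ← mul_assoc, ← pow_succ, pow_succ', mul_assoc, ← hc', Finset.mul_sum]
        simp [hβ', mul_assoc]
      rw [sub_eq_zero.1 (htpow _ _ this), map_mul, hρt, zero_mul]
    let π := Fintype.linearCombination A (fun j ↦ red (w j))
    have hπ : ∀ a : LinearMap.ker π, ∑ j, a.1 j • red (w j) = 0 := fun a ↦ a.2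
    choose lift hlift1 hlift2 using fun a : LinearMap.ker π ↦ hlift a.1 (hπ a)
    choose c hc using fun a ↦ hσm _ (hlift2 a)
    let l : LinearMap.ker π →ₗ[A] A :=
      { toFun := fun a ↦ ρ (c a)
        map_add' := fun a b ↦ by
          rw [← map_add, ← sub_eq_zero, ← map_sub]
          refine hwd (lift (a + b) - (lift a + lift b)) (fun j ↦ by simp [hlift1])
            (by simp [sub_smul, add_smul, Finset.sum_add_distrib, hlift2]) _ ?_
          simp [sub_mul, add_mul, mul_sub, mul_add, Finset.sum_add_distrib, hc]
        map_smul' := fun r a ↦ by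
          obtain ⟨r, rfl⟩ := hρ r
          rw [RingHom.id_apply, smul_eq_mul, ← map_mul, ← sub_eq_zero, ← map_sub]
          refine hwd (lift (ρ r • a) - fun j ↦ r * lift a j) (fun j ↦ by simp [hlift1])
            (by simp [sub_smul, mul_smul, ← Finset.smul_sum, hlift2]) _ ?_
          simp [sub_mul, mul_assoc, mul_sub, ← Finset.mul_sum, hc]
          rw [← mul_assoc, ← mul_assoc, ((ht r).pow_left _).eq] }
    obtain ⟨κ, hκ⟩ := hH l
    choose e he using fun j ↦ hρ (κ fun i ↦ if j = i then 1 else 0)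
    refine ⟨fun j ↦ σ j - t ^ (m + 1) * e j, fun j ↦ by simp [hσ, hρt], fun β hβ ↦ ?_⟩
    have hβπ : ∑ j, ρ (β j) • red (w j) = 0 := by
      simpa [map_sum, hred] using congrArg red hβ
    let a : LinearMap.ker π := ⟨fun j ↦ ρ (β j), hβπ⟩
    obtain ⟨c', hc'⟩ := hσm β hβ
    have h1 : ρ (c' - c a) = 0 := by
      refine hwd (β - lift a) (fun j ↦ by simp [hlift1, a]) (by simp [sub_smul, hβ, hlift2]) _ ?_
      simp [sub_mul, mul_sub, hc', hc]
    have h2 : ρ (c a) = ∑ j, ρ (β j) * ρ (e j) := by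
      have h3 : κ a.1 = ρ (c a) := hκ a
      simp only [← h3, he, κ.pi_apply_eq_sum_univ a.1, smul_eq_mul, a]
    obtain ⟨c'', hc''⟩ := hker (c' - ∑ j, β j * e j) (by
      rw [map_sub, map_sum]
      simp only [map_mul]
      rw [← h2, ← map_sub, h1])
    refine ⟨c'', ?_⟩
    rw [pow_succ t (m + 1), mul_assoc, ← hc'', mul_sub, ← hc', Finset.mul_sum,
      ← Finset.sum_sub_distrib]
    refine Finset.sum_congr rfl fun j _ ↦ ?_
    rw [mul_sub, ← mul_assoc, ← mul_assoc, ((ht (β j)).pow_left _).eq]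

/-- In the situation of `exists_lift_generators`, a linear map `u : D → A` lifts to a map
`W → B` which is linear modulo `t ^ (m + 1)`. -/
lemma exists_almost_linear_lift {A B D W J : Type} [CommRing A] [Ring B] [AddCommGroup D]
    [Module A D] [AddCommGroup W] [Module B W] [Fintype J] {t : B} (ht : ∀ β, Commute t β)
    (htB : ∀ β : B, t * β = 0 → β = 0) (htW : ∀ w : W, t • w = 0 → w = 0)
    (ρ : B →+* A) (hρ : Function.Surjective ρ) (hker : ∀ β, ρ β = 0 → ∃ β', β = t * β')
    (hρt : ρ t = 0)
    (red : W →+ D) (hred : ∀ (β : B) w, red (β • w) = ρ β • red w)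
    (hredker : ∀ w, red w = 0 → ∃ w', w = t • w')
    (w : J → W) (hw : ∀ v, ∃ c : J → B, v = ∑ j, c j • w j)
    (hH : ∀ l : LinearMap.ker (Fintype.linearCombination A (fun j ↦ red (w j))) →ₗ[A] A,
      ∃ κ : (J → A) →ₗ[A] A, ∀ v : LinearMap.ker _, κ v = l v)
    (u : D →ₗ[A] A) (m : ℕ) :
    ∃ U : W → B, (∀ g, ρ (U g) = u (red g)) ∧
      ∀ β g, ∃ c, U (β • g) = β * U g + t ^ (m + 1) * c := by
  obtain ⟨σ, hσ, hσm⟩ :=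
    exists_lift_generators ht htB htW ρ hρ hker hρt red hred hredker w hw hH u m
  choose c hc using hw
  refine ⟨fun g ↦ ∑ j, c g j * σ j, fun g ↦ ?_, fun β g ↦ ?_⟩
  · conv_rhs => rw [hc g]
    simp [map_sum, hred, hσ]
  · obtain ⟨e, he⟩ := hσm (fun j ↦ c (β • g) j - β * c g j)
      (by simp [sub_smul, mul_smul, ← Finset.smul_sum, ← hc])
    refine ⟨e, ?_⟩
    rw [← he]
    simp [sub_mul, mul_assoc, Finset.mul_sum]

section Deformation

open Polynomial TensorProduct

section Specialization

variable {k D : Type} [Field k] [AddCommGroup D] [Module k D]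

variable (k D) in
/-- The constant one-parameter family `k[X] ⊗ D` with fibre `D`. -/
def PolyFamily : Type := k[X] ⊗[k] D

namespace PolyFamily

instance : AddCommGroup (PolyFamily k D) := inferInstanceAs (AddCommGroup (k[X] ⊗[k] D))

instance : Module k[X] (PolyFamily k D) := inferInstanceAs (Module k[X] (k[X] ⊗[k] D))

instance : Module k (PolyFamily k D) := inferInstanceAs (Module k (k[X] ⊗[k] D))

instance : IsScalarTower k k[X] (PolyFamily k D) :=
  inferInstanceAs (IsScalarTower k k[X] (k[X] ⊗[k] D))

instance : Module.Free k[X] (PolyFamily k D) :=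
  inferInstanceAs (Module.Free k[X] (k[X] ⊗[k] D))

instance [FiniteDimensional k D] : Module.Finite k[X] (PolyFamily k D) :=
  inferInstanceAs (Module.Finite k[X] (k[X] ⊗[k] D))

variable (k) in
/-- Constant sections. -/
def const : D →ₗ[k] PolyFamily k D := TensorProduct.mk k k[X] D 1

/-- The endomorphism of the family which is constantly `T`. -/
def constEnd (T : Module.End k D) : Module.End k[X] (PolyFamily k D) := T.baseChange k[X]

/-- The linear form on the family which is constantly `φ`. -/
def constForm (φ : D →ₗ[k] k) : PolyFamily k D →ₗ[k[X]] k[X] :=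
  (AlgebraTensorModule.rid k k[X] k[X]).toLinearMap ∘ₗ φ.baseChange k[X]

/-- Specialization at `X = c`. -/
def evalAt (c : k) : PolyFamily k D →ₗ[k] D :=
  TensorProduct.lift (LinearMap.lsmul k D ∘ₗ leval c)

lemma induction_on {P : PolyFamily k D → Prop} (w : PolyFamily k D)
    (smul_const : ∀ (p : k[X]) v, P (p • const k v)) (add : ∀ v w, P v → P w → P (v + w)) :
    P w := by
  refine TensorProduct.induction_on (motive := P) w ?_ (fun p v ↦ ?_) add
  · have := smul_const 0 0
    rwa [zero_smul] at this
  · have : p ⊗ₜ[k] v = p • (1 ⊗ₜ[k] v : k[X] ⊗[k] D) := by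
      rw [smul_tmul', smul_eq_mul, mul_one]
    rw [this]
    exact smul_const p v

lemma evalAt_smul_const (c : k) (p : k[X]) (v : D) :
    evalAt c (p • const k v) = p.eval c • v := by
  change evalAt c ((p * 1) ⊗ₜ[k] v : k[X] ⊗[k] D) = _
  rw [mul_one]
  rfl

lemma evalAt_const (c : k) (v : D) : evalAt c (const k v) = v := by
  simpa using evalAt_smul_const c 1 v

lemma constEnd_const (T : Module.End k D) (v : D) : constEnd T (const k v) = const k (T v) := rfl

lemma evalAt_smul (c : k) (p : k[X]) (w : PolyFamily k D) :
    evalAt c (p • w) = p.eval c • evalAt c w := by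
  induction w using induction_on with
  | add v w hv hw => rw [smul_add, map_add, hv, hw, map_add, smul_add]
  | smul_const q v =>
    rw [smul_smul, evalAt_smul_const, evalAt_smul_const, eval_mul, mul_smul]

lemma evalAt_constEnd (c : k) (T : Module.End k D) (w : PolyFamily k D) :
    evalAt c (constEnd T w) = T (evalAt c w) := by
  induction w using induction_on with
  | add v w hv hw => rw [map_add, map_add, hv, hw, map_add, map_add]
  | smul_const q v =>
    rw [map_smul, constEnd_const, evalAt_smul_const, evalAt_smul_const, map_smul]

lemma eval_constForm (c : k) (φ : D →ₗ[k] k) (w : PolyFamily k D) :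
    (constForm φ w).eval c = φ (evalAt c w) := by
  induction w using induction_on with
  | add v w hv hw => rw [map_add, eval_add, hv, hw, map_add, map_add]
  | smul_const q v =>
    have : constForm φ (const k v) = φ v • (1 : k[X]) := rfl
    rw [map_smul, this, evalAt_smul_const]
    simp [mul_comm]

lemma commute_constEnd {S T : Module.End k D} (h : Commute S T) :
    Commute (constEnd S) (constEnd T) := by
  ext w
  induction w using induction_on with
  | add v w hv hw => rw [map_add, hv, hw, map_add]
  | smul_const q v =>
    simp only [Module.End.mul_apply, map_smul, constEnd_const]
    rw [← Module.End.mul_apply, h.eq, Module.End.mul_apply]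

lemma exists_eq_const_evalAt_add (c : k) (w : PolyFamily k D) :
    ∃ w', w = const k (evalAt c w) + (X - C c) • w' := by
  induction w using induction_on with
  | add v w hv hw =>
    obtain ⟨v', hv'⟩ := hv
    obtain ⟨w', hw'⟩ := hw
    refine ⟨v' + w', ?_⟩
    conv_lhs => rw [hv', hw']
    rw [map_add, map_add, smul_add]
    abel
  | smul_const q v =>
    obtain ⟨r, hr⟩ := X_sub_C_dvd_sub_C_eval (a := c) (p := q)
    refine ⟨r • const k v, ?_⟩
    rw [evalAt_smul_const, smul_smul, ← hr, map_smul, sub_smul, ← algebraMap_eq,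
      algebraMap_smul, add_sub_cancel]

lemma exists_sum_smul_const {J : Type} [Fintype J] (b : Module.Basis J k D) (w : PolyFamily k D) :
    ∃ c : J → k[X], w = ∑ j, c j • const k (b j) := by
  induction w using induction_on with
  | add v w hv hw =>
    obtain ⟨⟨c, rfl⟩, ⟨c', rfl⟩⟩ := And.intro hv hw
    exact ⟨c + c', by simp [add_smul, Finset.sum_add_distrib]⟩
  | smul_const q v =>
    refine ⟨fun j ↦ q * C (b.repr v j), ?_⟩
    conv_lhs => rw [← b.sum_repr v, map_sum, Finset.smul_sum]
    refine Finset.sum_congr rfl fun j _ ↦ ?_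
    rw [mul_smul, ← algebraMap_eq, algebraMap_smul, map_smul]

lemma exists_eq_X_smul_of_evalAt_zero {w : PolyFamily k D} (hw : evalAt (0 : k) w = 0) :
    ∃ w', w = (X : k[X]) • w' := by
  obtain ⟨w', hw'⟩ := exists_eq_const_evalAt_add 0 w
  exact ⟨w', by simpa [hw] using hw'⟩

lemma X_smul_injective : Function.Injective fun w : PolyFamily k D ↦ (X : k[X]) • w :=
  smul_right_injective _ X_ne_zero

/-- An endomorphism whose specialization at `0` vanishes is divisible by `X`. -/
lemma exists_eq_X_smul_of_forall_evalAt_zero {M : Module.End k[X] (PolyFamily k D)}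
    (hM : ∀ w, evalAt (0 : k) (M w) = 0) : ∃ M', M = (X : k[X]) • M' := by
  choose f hf using fun w ↦ exists_eq_X_smul_of_evalAt_zero (hM w)
  refine ⟨{ toFun := f
            map_add' := fun v w ↦ X_smul_injective ?_
            map_smul' := fun p w ↦ X_smul_injective ?_ }, LinearMap.ext hf⟩
  · simp only [smul_add, ← hf, map_add]
  · simp only [RingHom.id_apply, smul_comm (X : k[X]) p, ← hf, map_smul]

/-- If a subalgebra `B₀` of endomorphisms of `k[X] ⊗ D` generates everything from `w₀` after
specialization at `c`, then it generates up to a nonzero polynomial. -/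
lemma exists_ne_zero_smul_mem_of_evalAt [FiniteDimensional k D] (c : k)
    (B₀ : Subalgebra k[X] (Module.End k[X] (PolyFamily k D))) (w₀ : PolyFamily k D)
    (h : ∀ v : D, ∃ a ∈ B₀, evalAt c (a w₀) = v) :
    ∃ p : k[X], p ≠ 0 ∧ ∀ w, ∃ a ∈ B₀, p • w = a w₀ := by
  let S : Submodule k[X] (PolyFamily k D) :=
    B₀.toSubmodule.map (LinearMap.applyₗ (R := k[X]) (M₂ := PolyFamily k D) w₀)
  let I : Ideal k[X] := Ideal.span {X - C c}
  have hle : (⊤ : Submodule k[X] (PolyFamily k D ⧸ S)) ≤ I • ⊤ := by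
    rintro w -
    obtain ⟨w, rfl⟩ := S.mkQ_surjective w
    obtain ⟨a, ha, haw⟩ := h (evalAt c w)
    obtain ⟨w', hw'⟩ := exists_eq_const_evalAt_add c (w - a w₀)
    rw [map_sub, haw, sub_self, map_zero, zero_add, sub_eq_iff_eq_add] at hw'
    have haS : S.mkQ (a w₀) = 0 := by
      rw [Submodule.mkQ_apply, Submodule.Quotient.mk_eq_zero]
      exact ⟨a, ha, rfl⟩
    rw [hw', map_add, haS, add_zero, map_smul]
    exact Submodule.smul_mem_smul (Ideal.mem_span_singleton_self _) trivial
  obtain ⟨p, hp, hpw⟩ := Submodule.exists_sub_one_mem_and_smul_eq_zero_of_fg_of_le_smul I _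
    (Module.Finite.fg_top) hle
  refine ⟨p, ?_, fun w ↦ ?_⟩
  · rintro rfl
    rw [Ideal.mem_span_singleton, dvd_iff_isRoot] at hp
    simp at hp
  · have := hpw (S.mkQ w) trivial
    rw [← map_smul, Submodule.mkQ_apply, Submodule.Quotient.mk_eq_zero] at this
    obtain ⟨a, ha, haw⟩ := this
    exact ⟨a, ha, haw.symm⟩

end PolyFamily

end Specialization

open PolyFamily

/-- A ring hom from a subalgebra `B` of endomorphisms of `k[X] ⊗ D` to `A`, when the
specializations at `0` of elements of `B` are given by the action of `A` on `D`. -/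
lemma exists_ringHom_of_evalAt {k A D : Type} [Field k] [CommRing A] [AddCommGroup D]
    [Module k D] [Module A D] (hfaith : ∀ a : A, (∀ v : D, a • v = 0) → a = 0)
    (B : Subalgebra k[X] (Module.End k[X] (PolyFamily k D)))
    (hB : ∀ M ∈ B, ∃ a : A, ∀ w, evalAt (0 : k) (M w) = a • evalAt (0 : k) w) :
    ∃ ρ : B →+* A, ∀ (M : B) w, evalAt (0 : k) (M.1 w) = ρ M • evalAt (0 : k) w := by
  choose ρ hρ using fun M : B ↦ hB M.1 M.2
  have huniq : ∀ a b : A, (∀ w : PolyFamily k D,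
      a • evalAt (0 : k) w = b • evalAt (0 : k) w) → a = b := by
    intro a b h
    rw [← sub_eq_zero]
    refine hfaith _ fun v ↦ ?_
    have := h (const k v)
    rw [evalAt_const] at this
    rw [sub_smul, this, sub_self]
  refine ⟨{ toFun := ρ
            map_one' := huniq _ _ fun w ↦ ?_
            map_mul' := fun M M' ↦ huniq _ _ fun w ↦ ?_
            map_zero' := huniq _ _ fun w ↦ ?_
            map_add' := fun M M' ↦ huniq _ _ fun w ↦ ?_ }, hρ⟩
  · rw [← hρ, one_smul]; rfl
  · rw [← hρ, mul_smul, ← hρ, ← hρ]; rfl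
  · rw [← hρ, zero_smul]; exact map_zero _
  · rw [← hρ, add_smul, ← hρ, ← hρ, ← map_add]; rfl

/-- If `A` is generated by two elements over `k`, `End_A D = A`, and maps from syzygies of `D` to
`A` extend, then for every `u : D → A` the form `(f, g) ↦ u g • f` is symmetric. -/
lemma symmetric_of_extension {k A D : Type} [Field k] [CommRing A] [Algebra k A]
    [AddCommGroup D] [Module k D] [Module A D] [IsScalarTower k A D] [FiniteDimensional k D]
    {x y : A} (hxy : Algebra.adjoin k {x, y} = ⊤) (hy : IsNilpotent y)
    (hEnd : ∀ φ : D →ₗ[A] D, ∃ a : A, ∀ v, φ v = a • v)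
    (hfaith : ∀ a : A, (∀ v : D, a • v = 0) → a = 0)
    (hH : ∀ (J : Type) [Fintype J] (b : J → D),
      Function.Surjective (Fintype.linearCombination A b) →
      ∀ l : LinearMap.ker (Fintype.linearCombination A b) →ₗ[A] A,
      ∃ κ : (J → A) →ₗ[A] A, ∀ v : LinearMap.ker _, κ v = l v)
    (u : D →ₗ[A] A) (ev : D →ₗ[k] k) (f g : D) : ev (u g • f) = ev (u f • g) := by
  let act : A →ₐ[k] Module.End k D := Algebra.lsmul k k D
  have hact : ∀ a v, act a v = a • v := fun _ _ ↦ rfl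
  obtain ⟨N, d, hNy, hNd⟩ := exists_commuting_endomorphism_cyclic (act y) (hy.map act)
  let Xs : Module.End k[X] (PolyFamily k D) :=
    (1 - X : k[X]) • constEnd (act x) + (X : k[X]) • constEnd N
  let Y : Module.End k[X] (PolyFamily k D) := constEnd (act y)
  have hcomm : Commute Xs Y := by
    exact ((commute_constEnd ((Commute.all x y).map act)).smul_left _).add_left
      ((commute_constEnd hNy).smul_left _)
  have hXs0 : ∀ w, evalAt (0 : k) (Xs w) = x • evalAt (0 : k) w := fun w ↦ by
    simp [Xs, evalAt_smul, evalAt_constEnd, hact]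
  have hXs1 : ∀ w, evalAt (1 : k) (Xs w) = N (evalAt (1 : k) w) := fun w ↦ by
    simp [Xs, evalAt_smul, evalAt_constEnd]
  have hY : ∀ c w, evalAt c (Y w) = y • evalAt c w := fun c w ↦ by
    simp [Y, evalAt_constEnd, hact]
  let B₀ := Algebra.adjoin k[X] {Xs, Y}
  let B := Subalgebra.centralizer k[X] {Xs, Y}
  have hB₀B : ∀ a ∈ B₀, ∀ β ∈ B, β * a = a * β := by
    intro a ha β hβ
    exact Subalgebra.mem_centralizer_iff _ |>.1
      (Algebra.adjoin_le_centralizer_centralizer k[X] {Xs, Y} ha) β hβ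
  have hXsB : Xs ∈ B := by
    rw [Subalgebra.mem_centralizer_iff]
    rintro _ (rfl | rfl)
    exacts [rfl, hcomm.eq.symm]
  have hYB : Y ∈ B := by
    rw [Subalgebra.mem_centralizer_iff]
    rintro _ (rfl | rfl)
    exacts [hcomm.eq, rfl]
  have hB₀ : B₀ ≤ B := Algebra.adjoin_le (by rintro _ (rfl | rfl) <;> assumption)
  have hBX : ∀ M ∈ B, Xs * M = M * Xs := fun M hM ↦
    Subalgebra.mem_centralizer_iff _ |>.1 hM _ (by simp)
  have hBY : ∀ M ∈ B, Y * M = M * Y := fun M hM ↦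
    Subalgebra.mem_centralizer_iff _ |>.1 hM _ (by simp)
  obtain ⟨ρ, hρ⟩ := exists_ringHom_of_evalAt hfaith B (by
    intro M hM
    have hfac : ∀ w, evalAt (0 : k) (M w) =
        evalAt (0 : k) (M (const k (evalAt (0 : k) w))) := by
      intro w
      obtain ⟨w', hw'⟩ := exists_eq_const_evalAt_add 0 w
      conv_lhs => rw [hw']
      simp [evalAt_smul]
    let φ₀ : D →ₗ[k] D :=
      evalAt (0 : k) ∘ₗ M.restrictScalars k ∘ₗ const k
    have hφ₀ : ∀ w, evalAt (0 : k) (M w) = φ₀ (evalAt (0 : k) w) := hfac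
    have hspec : ∀ v : D, evalAt (0 : k) (const k v) = v := fun v ↦ by simp [evalAt_const]
    have hφ : ∀ (a : A) v, φ₀ (a • v) = a • φ₀ v := by
      intro a
      have ha : a ∈ Algebra.adjoin k {x, y} := hxy ▸ Algebra.mem_top
      induction ha using Algebra.adjoin_induction with
      | mem a ha =>
        intro v
        rcases ha with rfl | rfl
        · conv_lhs => rw [← hspec v, ← hXs0, ← hφ₀, ← Module.End.mul_apply, ← hBX M hM,
            Module.End.mul_apply, hXs0, hφ₀, hspec]
        · conv_lhs => rw [← hspec v, ← hY, ← hφ₀, ← Module.End.mul_apply, ← hBY M hM,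
            Module.End.mul_apply, hY, hφ₀, hspec]
      | algebraMap c => intro v; rw [algebraMap_smul, algebraMap_smul, map_smul]
      | add a b _ _ ha hb => intro v; rw [add_smul, map_add, ha, hb, add_smul]
      | mul a b _ _ ha hb => intro v; rw [mul_smul, ha, hb, mul_smul]
    obtain ⟨a, ha⟩ := hEnd { φ₀ with map_smul' := hφ }
    exact ⟨a, fun w ↦ (hφ₀ w).trans (ha _)⟩)
  have hρ_eq : ∀ (M : B) (a : A), (∀ w, evalAt (0 : k) (M.1 w) = a • evalAt (0 : k) w) →
      ρ M = a := by
    intro M a h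
    rw [← sub_eq_zero]
    refine hfaith _ fun v ↦ ?_
    have := (hρ M (const k v)).symm.trans (h (const k v))
    rw [evalAt_const] at this
    rw [sub_smul, this, sub_self]
  have hρsurj : Function.Surjective ρ := by
    intro a
    have ha : a ∈ Algebra.adjoin k {x, y} := hxy ▸ Algebra.mem_top
    induction ha using Algebra.adjoin_induction with
    | mem a ha =>
      rcases ha with rfl | rfl
      exacts [⟨⟨Xs, hXsB⟩, hρ_eq _ _ hXs0⟩, ⟨⟨Y, hYB⟩, hρ_eq _ _ (hY 0)⟩]
    | algebraMap c =>
      refine ⟨algebraMap k[X] B (C c), hρ_eq _ _ fun w ↦ ?_⟩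
      rw [algebraMap_smul]
      exact (evalAt_smul 0 (C c) w).trans (by rw [eval_C])
    | add a b _ _ ha hb =>
      obtain ⟨⟨M, rfl⟩, ⟨M', rfl⟩⟩ := And.intro ha hb
      exact ⟨M + M', map_add _ _ _⟩
    | mul a b _ _ ha hb =>
      obtain ⟨⟨M, rfl⟩, ⟨M', rfl⟩⟩ := And.intro ha hb
      exact ⟨M * M', map_mul _ _ _⟩
  let t : B := algebraMap k[X] B X
  have htpow : ∀ n (w : PolyFamily k D), (t ^ n : B) • w = (X ^ n : k[X]) • w := by
    intro n w
    rw [← map_pow, algebraMap_smul]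
  obtain ⟨p, hp0, hp⟩ := exists_ne_zero_smul_mem_of_evalAt (1 : k) B₀ (const k d) (by
    let S : Submodule k D :=
      (B₀.toSubmodule.restrictScalars k).map (evalAt (1 : k) ∘ₗ
        (LinearMap.applyₗ (R := k[X]) (M₂ := PolyFamily k D) (const k d)).restrictScalars k)
    have hS : S = ⊤ := by
      refine hNd S ⟨1, B₀.one_mem, by simp [evalAt_const]⟩ ?_ ?_
      · rintro _ ⟨a, ha, rfl⟩
        exact ⟨Xs * a, B₀.mul_mem (Algebra.subset_adjoin (by simp)) ha, hXs1 _⟩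
      · rintro _ ⟨a, ha, rfl⟩
        exact ⟨Y * a, B₀.mul_mem (Algebra.subset_adjoin (by simp)) ha, hY _ _⟩
    intro v
    obtain ⟨a, ha, h⟩ : v ∈ S := hS ▸ Submodule.mem_top
    exact ⟨a, ha, h⟩)
  let b := Module.finBasis k D
  obtain ⟨m, hm⟩ : ∃ m, ¬ (X : k[X]) ^ (m + 1) ∣ p ^ 2 := by
    refine ⟨(p ^ 2).natDegree, fun h ↦ ?_⟩
    have := natDegree_le_of_dvd h (pow_ne_zero 2 hp0)
    rw [natDegree_X_pow] at this
    omega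
  obtain ⟨U, hU, hUm⟩ := exists_almost_linear_lift (A := A) (B := B) (D := D) (W := PolyFamily k D)
    (J := Fin (Module.finrank k D)) (t := t) (fun β ↦ Algebra.commutes _ _)
    (fun β h ↦ by
      ext w
      refine X_smul_injective (k := k) ?_
      have := congrArg (fun M : B ↦ M.1 w) h
      simpa [t] using this)
    (fun w h ↦ X_smul_injective (k := k) (by simpa [t] using h))
    ρ hρsurj
    (fun β h ↦ by
      obtain ⟨M', hM'⟩ := exists_eq_X_smul_of_forall_evalAt_zero (M := β.1) fun w ↦ by
        rw [hρ, h, zero_smul]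
      refine ⟨⟨M', ?_⟩, ?_⟩
      · have hcancel : ∀ Z, Z * β.1 = β.1 * Z → Z * M' = M' * Z := by
          intro Z h
          ext w
          refine X_smul_injective (k := k) ?_
          rw [hM'] at h
          simpa using LinearMap.congr_fun h w
        rw [Subalgebra.mem_centralizer_iff]
        rintro _ (rfl | rfl)
        exacts [hcancel _ (hBX _ β.2), hcancel _ (hBY _ β.2)]
      · refine Subtype.ext (hM'.trans ?_)
        ext w
        simp [t])
    (hρ_eq _ _ fun w ↦ (evalAt_smul 0 X w).trans (by simp))
    (evalAt (0 : k)).toAddMonoidHom hρ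
    (fun w h ↦ by
      obtain ⟨w', hw'⟩ := exists_eq_X_smul_of_evalAt_zero h
      exact ⟨w', by simpa [t] using hw'⟩)
    (fun j ↦ const k (b j))
    (fun v ↦ by
      obtain ⟨c, hc⟩ := exists_sum_smul_const b v
      exact ⟨fun j ↦ algebraMap k[X] B (c j), by simpa [algebraMap_smul] using hc⟩)
    (hH _ _ fun v ↦ ⟨fun j ↦ algebraMap k A (b.repr v j), by
      simp [Fintype.linearCombination_apply, evalAt_const, b.sum_repr]⟩)
    u m
  let E : PolyFamily k D →ₗ[k[X]] k[X] := constForm ev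
  have hform : ∀ F G, ∀ a ∈ B₀, ∀ a' ∈ B₀, p • F = a (const k d) → p • G = a' (const k d) →
      ∃ r, p ^ 2 * E ((U G).1 F) = E ((U (const k d)).1 ((a' * a) (const k d))) +
        X ^ (m + 1) * r := by
    intro F G a ha a' ha' hF hG
    obtain ⟨c₁, hc₁⟩ := hUm (algebraMap k[X] B p) G
    obtain ⟨c₂, hc₂⟩ := hUm ⟨a', hB₀ ha'⟩ (const k d)
    have hsmul : (⟨a', hB₀ ha'⟩ : B) • const k d = algebraMap k[X] B p • G := by
      rw [algebraMap_smul, hG]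
      rfl
    rw [hsmul, hc₁] at hc₂
    have h := congrArg (fun M : B ↦ M • p • F) (eq_sub_of_add_eq hc₂)
    simp only [sub_smul, add_smul, mul_smul, htpow, algebraMap_smul] at h
    refine ⟨E (c₂ • p • F) - E (c₁ • p • F), ?_⟩
    have hcomm' : (⟨a', hB₀ ha'⟩ : B) • U (const k d) • p • F =
        (U (const k d)).1 ((a' * a) (const k d)) := by
      rw [hF]
      exact (LinearMap.congr_fun (hB₀B a' ha' _ (U (const k d)).2) (a (const k d))).symm
    rw [hcomm'] at h
    have h' := congrArg E h
    rw [map_sub, map_add, E.map_smul p, E.map_smul (X ^ (m + 1)), E.map_smul (X ^ (m + 1))] at h'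
    have hlin : E (U G • p • F) = p * E ((U G).1 F) := by
      rw [← smul_eq_mul, ← map_smul, ← map_smul]
      rfl
    rw [hlin] at h'
    simp only [smul_eq_mul] at h'
    linear_combination h'
  obtain ⟨a, ha, hfa⟩ := hp (const k f)
  obtain ⟨a', ha', hga'⟩ := hp (const k g)
  obtain ⟨r, hr⟩ := hform _ _ a ha a' ha' hfa hga'
  obtain ⟨r', hr'⟩ := hform _ _ a' ha' a ha hga' hfa
  rw [← hB₀B a' ha' a (hB₀ ha)] at hr
  have hdvd : X ∣ E ((U (const k g)).1 (const k f)) - E ((U (const k f)).1 (const k g)) := by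
    by_contra hnd
    exact hm (prime_X.pow_dvd_of_dvd_mul_right _ hnd
      ⟨r - r', by linear_combination hr - hr'⟩)
  rw [X_dvd_iff, coeff_zero_eq_eval_zero, eval_sub, sub_eq_zero] at hdvd
  have hU' : ∀ f, ρ (U (const k f)) = u f := fun f ↦
    (hU _).trans (congrArg u (evalAt_const 0 f))
  simpa only [E, eval_constForm, hρ, hU', evalAt_const] using hdvd

end Deformation

section Dual

variable {k A : Type} [Field k] [CommRing A] [Algebra k A]

lemma dualModule_smul_apply (a : A) (f : A →ₗ[k] k) (x : A) : (a • f) x = f (a * x) := rfl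

instance : IsScalarTower k A (A →ₗ[k] k) :=
  ⟨fun c a f ↦ by
    ext x
    rw [dualModule_smul_apply, smul_mul_assoc, map_smul]
    rfl⟩

lemma eq_zero_of_forall_dual_smul_eq_zero (a : A) (h : ∀ f : A →ₗ[k] k, a • f = 0) : a = 0 :=
  (Module.forall_dual_apply_eq_zero_iff k a).1 fun f ↦ by
    simpa [dualModule_smul_apply] using LinearMap.congr_fun (h f) 1

/-- Endomorphisms of the dual of `A` are given by multiplication with elements of `A`. -/
lemma exists_forall_dual_end_eq_smul [FiniteDimensional k A]
    (φ : (A →ₗ[k] k) →ₗ[A] (A →ₗ[k] k)) : ∃ a : A, ∀ f, φ f = a • f := by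
  let ψ : Module.Dual k (Module.Dual k A) :=
    LinearMap.applyₗ (1 : A) ∘ₗ φ.restrictScalars k
  obtain ⟨a, ha⟩ := (Module.evalEquiv k A).surjective ψ
  refine ⟨a, fun f ↦ LinearMap.ext fun x ↦ ?_⟩
  have h : (x • f) a = φ (x • f) 1 := LinearMap.congr_fun ha (x • f)
  rw [map_smul, dualModule_smul_apply, dualModule_smul_apply, mul_one] at h
  rw [dualModule_smul_apply, ← h, mul_comm]

lemma dual_baer : Module.Baer A (A →ₗ[k] k) := by
  intro I g
  let φ : I.restrictScalars k →ₗ[k] k :=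
    { toFun := fun i ↦ g i 1
      map_add' := fun i j ↦ LinearMap.congr_fun (map_add g i j) 1
      map_smul' := fun c i ↦ LinearMap.congr_fun (LinearMap.map_smul_of_tower g c i) 1 }
  obtain ⟨ψ, hψ⟩ := LinearMap.exists_extend φ
  refine ⟨LinearMap.toSpanSingleton A _ ψ, fun x hx ↦ LinearMap.ext fun z ↦ ?_⟩
  have h : ψ (z * x) = g (z • ⟨x, hx⟩) 1 := LinearMap.congr_fun hψ ⟨z * x, I.mul_mem_left z hx⟩
  rw [map_smul, dualModule_smul_apply, mul_one] at h
  rw [LinearMap.toSpanSingleton_apply, dualModule_smul_apply, mul_comm, h]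

end Dual

section Local

open IsLocalRing

variable {k A : Type} [Field k] [CommRing A] [Algebra k A] [IsLocalRing A]

lemma exists_sub_algebraMap_mem
    (hres : Function.Surjective (algebraMap k (A ⧸ maximalIdeal A))) (a : A) :
    ∃ c : k, a - algebraMap k A c ∈ maximalIdeal A := by
  obtain ⟨c, hc⟩ := hres (Ideal.Quotient.mk _ a)
  exact ⟨c, Ideal.Quotient.eq.1 hc.symm⟩

lemma isNilpotent_maximalIdeal_of_finiteDimensional (k : Type) [Field k] [Algebra k A]
    [FiniteDimensional k A] : IsNilpotent (maximalIdeal A) := by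
  have : IsArtinianRing A := IsArtinianRing.of_finite k A
  rw [← jacobson_eq_maximalIdeal ⊥ bot_ne_top]
  exact IsArtinianRing.isNilpotent_jacobson_bot

/-- Generators of the maximal ideal generate the algebra. -/
lemma adjoin_eq_top_of_span_eq_maximalIdeal [FiniteDimensional k A]
    (hres : Function.Surjective (algebraMap k (A ⧸ maximalIdeal A))) {s : Set A}
    (hs : Ideal.span s = maximalIdeal A) : Algebra.adjoin k s = ⊤ := by
  have h : ∀ n (a : A), ∃ b ∈ Algebra.adjoin k s, a - b ∈ maximalIdeal A ^ n := by
    intro n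
    induction n with
    | zero => exact fun a ↦ ⟨0, zero_mem _, by simp⟩
    | succ n ih =>
      intro a
      obtain ⟨c, hc⟩ := exists_sub_algebraMap_mem hres a
      suffices h : ∀ z ∈ maximalIdeal A, ∃ b ∈ Algebra.adjoin k s,
          z - b ∈ maximalIdeal A ^ (n + 1) by
        obtain ⟨b, hb, hab⟩ := h _ hc
        exact ⟨algebraMap k A c + b, add_mem (Subalgebra.algebraMap_mem _ c) hb,
          by rwa [← sub_sub]⟩
      intro z hz
      rw [← hs] at hz
      induction hz using Submodule.span_induction with
      | mem z hz => exact ⟨z, Algebra.subset_adjoin hz, by simp⟩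
      | zero => exact ⟨0, zero_mem _, by simp⟩
      | add z w _ _ hz hw =>
        obtain ⟨b, hb, hzb⟩ := hz
        obtain ⟨b', hb', hwb'⟩ := hw
        exact ⟨b + b', add_mem hb hb', by rw [add_sub_add_comm]; exact add_mem hzb hwb'⟩
      | smul r z hz' hz =>
        obtain ⟨b, hb, hzb⟩ := hz
        obtain ⟨b', hb', hrb'⟩ := ih r
        refine ⟨b' * b, mul_mem hb' hb, ?_⟩
        have hz'' : z ∈ maximalIdeal A := hs ▸ hz'
        have heq : r • z - b' * b = (r - b') * z + b' * (z - b) := by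
          rw [smul_eq_mul]; ring
        rw [heq]
        exact add_mem (pow_succ (maximalIdeal A) n ▸ Ideal.mul_mem_mul hrb' hz'')
          (Ideal.mul_mem_left _ _ hzb)
  obtain ⟨n, hn⟩ := isNilpotent_maximalIdeal_of_finiteDimensional (A := A) k
  rw [eq_top_iff]
  rintro a -
  obtain ⟨b, hb, hab⟩ := h n a
  rw [hn, Ideal.zero_eq_bot, Ideal.mem_bot, sub_eq_zero] at hab
  exact hab ▸ hb

/-- A nonzero element of a local ring with nilpotent maximal ideal has a nonzero multiple in the
socle. -/
lemma exists_mul_ne_zero_mem_socle (hnil : IsNilpotent (maximalIdeal A)) {a : A} (ha : a ≠ 0) :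
    ∃ c, c * a ≠ 0 ∧ ∀ z ∈ maximalIdeal A, z * (c * a) = 0 := by
  classical
  obtain ⟨n, hn⟩ := hnil
  have hex : ∃ n, ∀ z ∈ maximalIdeal A ^ n, z * a = 0 := ⟨n, fun z hz ↦ by
    rw [hn, Ideal.zero_eq_bot, Ideal.mem_bot] at hz
    rw [hz, zero_mul]⟩
  have hmin := Nat.find_spec hex
  obtain ⟨m, hm⟩ : ∃ m, Nat.find hex = m + 1 := Nat.exists_eq_succ_of_ne_zero fun h ↦ by
    rw [h] at hmin
    exact ha (by simpa using hmin 1 (by simp))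
  have hlt := Nat.find_min hex (m := m) (by omega)
  push Not at hlt
  obtain ⟨c, hc, hca⟩ := hlt
  refine ⟨c, hca, fun z hz ↦ ?_⟩
  rw [← mul_assoc, mul_comm z]
  exact hmin _ (by rw [hm, pow_succ]; exact Ideal.mul_mem_mul hc hz)

lemma exists_span_pair_eq_maximalIdeal (h : embDim A ≤ 2) :
    ∃ x y : A, Ideal.span {x, y} = maximalIdeal A := by
  obtain ⟨s, hs, hspan⟩ : ∃ s : Finset A, (s.card : ℕ∞) ≤ 2 ∧
      Ideal.span (s : Set A) = maximalIdeal A := by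
    have hlt : embDim A < 3 := h.trans_lt (by norm_num)
    obtain ⟨n, ⟨s, rfl, hs⟩, hn⟩ := sInf_lt_iff.1 hlt
    refine ⟨s, ?_, hs⟩
    have : s.card < 3 := by exact_mod_cast hn
    exact_mod_cast Nat.lt_succ_iff.1 this
  have hcard : s.card ≤ 2 := by exact_mod_cast hs
  classical
  interval_cases hc : s.card
  · rw [Finset.card_eq_zero] at hc
    exact ⟨0, 0, by rw [← hspan, hc]; simp⟩
  · obtain ⟨x, rfl⟩ := Finset.card_eq_one.1 hc
    exact ⟨x, x, by rw [← hspan]; simp⟩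
  · obtain ⟨x, y, -, rfl⟩ := Finset.card_eq_two.1 hc
    exact ⟨x, y, by rw [← hspan]; simp⟩

/-- If all forms `(f, g) ↦ f (u g)` on the dual of `A` are symmetric, then `A` is selfinjective. -/
lemma injective_of_forall_dual_symmetric [FiniteDimensional k A]
    (hres : Function.Surjective (algebraMap k (A ⧸ maximalIdeal A)))
    (hsymm : ∀ (u : (A →ₗ[k] k) →ₗ[A] A) (f g : A →ₗ[k] k), f (u g) = g (u f)) :
    Module.Injective A A := by
  have hnil := isNilpotent_maximalIdeal_of_finiteDimensional (A := A) k
  obtain ⟨s, hs0, hs⟩ := exists_mul_ne_zero_mem_socle hnil (one_ne_zero (α := A))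
  obtain ⟨f, hf⟩ : ∃ f : A →ₗ[k] k, f (s * 1) ≠ 0 := by
    by_contra! h
    exact hs0 ((Module.forall_dual_apply_eq_zero_iff k _).1 h)
  generalize s * 1 = s at hs0 hs hf
  have hsocle : ∀ z, (∀ r ∈ maximalIdeal A, r * z = 0) → f z = 0 → z = 0 := by
    intro z hz hfz
    let u : (A →ₗ[k] k) →ₗ[A] A :=
      { toFun := fun g ↦ g s • z
        map_add' := fun g h ↦ by rw [LinearMap.add_apply, add_smul]
        map_smul' := fun a g ↦ by
          obtain ⟨c, hc⟩ := exists_sub_algebraMap_mem hres a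
          have h1 : a * s = c • s := by
            rw [Algebra.smul_def, ← sub_eq_zero, ← sub_mul, hs _ hc]
          have h2 : a * z = c • z := by
            rw [Algebra.smul_def, ← sub_eq_zero, ← sub_mul, hz _ hc]
          rw [RingHom.id_apply, dualModule_smul_apply, h1, map_smul, smul_eq_mul, smul_eq_mul,
            mul_smul_comm, h2, smul_smul, mul_comm] }
    refine (Module.forall_dual_apply_eq_zero_iff k z).1 fun g ↦ ?_
    have h : f (g s • z) = g (f s • z) := hsymm u f g
    rw [map_smul, map_smul, hfz, smul_zero] at h
    exact (smul_eq_zero.1 h.symm).resolve_left hf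
  let ι : A →ₗ[A] (A →ₗ[k] k) := LinearMap.toSpanSingleton A _ f
  have hι : Function.Injective ι := by
    rw [injective_iff_map_eq_zero]
    intro a ha
    by_contra ha0
    obtain ⟨c, hca, hc⟩ := exists_mul_ne_zero_mem_socle hnil ha0
    refine hca (hsocle _ hc ?_)
    have h : (a • f) c = 0 := LinearMap.congr_fun ha c
    rwa [dualModule_smul_apply, mul_comm] at h
  have hbij : Function.Bijective ι := by
    refine ⟨hι, ?_⟩
    have := LinearMap.injective_iff_surjective_of_finrank_eq_finrank
      (f := ι.restrictScalars k) (Subspace.dual_finrank_eq (K := k) (V := A)).symm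
    exact this.1 hι
  exact (Module.Baer.of_equiv (LinearEquiv.ofBijective ι hbij).symm dual_baer).injective

end Local

/-- Let `A` be a commutative local algebra of finite rank over a field
`k` (with residue field `k`) such that `edim A ≤ 2`.  If `Ext^1_A(Hom_k(A, k), A) = 0`,
then `A` is selfinjective. -/
theorem selfinjective_of_embDim_le_two_of_ext_one_vanishes
    (k A : Type) [Field k] [CommRing A] [Algebra k A] [FiniteDimensional k A]
    [IsLocalRing A]
    (hres : Function.Bijective (algebraMap k (A ⧸ IsLocalRing.maximalIdeal A)))
    (hedim : embDim A ≤ 2)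
    (hext : Limits.IsZero (((Ext A (ModuleCat A) 1).obj
      (Opposite.op (ModuleCat.of A (A →ₗ[k] k)))).obj (ModuleCat.of A A))) :
    Module.Injective A A := by
  obtain ⟨x, y, hxy⟩ := exists_span_pair_eq_maximalIdeal hedim
  have hy : IsNilpotent y := by
    obtain ⟨n, hn⟩ := isNilpotent_maximalIdeal_of_finiteDimensional (A := A) k
    refine ⟨n, ?_⟩
    have : y ^ n ∈ IsLocalRing.maximalIdeal A ^ n :=
      Ideal.pow_mem_pow (hxy ▸ Ideal.subset_span (by simp)) n
    rwa [hn, Ideal.zero_eq_bot, Ideal.mem_bot] at this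
  refine injective_of_forall_dual_symmetric hres.surjective fun u f g ↦ ?_
  have h := symmetric_of_extension (D := A →ₗ[k] k)
    (adjoin_eq_top_of_span_eq_maximalIdeal hres.surjective hxy) hy
    exists_forall_dual_end_eq_smul eq_zero_of_forall_dual_smul_eq_zero
    (fun J _ b hb l ↦ exists_extension_of_isZero_ext_one hext _ hb l) u
    (LinearMap.applyₗ (1 : A)) f g
  simpa [dualModule_smul_apply] using h
end
end

section
/- Let A be a commutative local algebra of finite rank over a field k such that A ≅ Q/(f), where Q is a reduced complete local ring and f is a Q-regular sequence. If Ext^1_A(Hom_k(A,k), A) = 0, then A is selfinjective. -/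
open CategoryTheory

noncomputable section

namespace DualizingLift

open Submodule IsLocalRing RingTheory.Sequence
open scoped Pointwise

section Nakayama

variable {R : Type} [CommRing R]

theorem mem_smul_top_iff {N : Type*} [AddCommGroup N] [Module R N] {r : R} {x : N} :
    x ∈ (r • ⊤ : Submodule R N) ↔ ∃ y, r • y = x := by
  simp [Submodule.mem_smul_pointwise_iff_exists]

variable (R) in
/-- The quotient of `N` by the empty sequence is `N`. -/
def quotOfListNilEquiv (N : Type*) [AddCommGroup N] [Module R N] :
    (N ⧸ (Ideal.ofList ([] : List R) • ⊤ : Submodule R N)) ≃ₗ[R] N :=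
  quotEquivOfEqBot _ ((congrArg (· • ⊤) Ideal.ofList_nil).trans (bot_smul ⊤))

/-- A linear map with values in `rN` is divisible by `r` if `r` is regular on `N`. -/
theorem exists_smul_eq_of_forall_mem {M N : Type*} [AddCommGroup M] [Module R M]
    [AddCommGroup N] [Module R N] {r : R} (hr : IsSMulRegular N r) (g : M →ₗ[R] N)
    (hg : ∀ x, g x ∈ (r • ⊤ : Submodule R N)) : ∃ g' : M →ₗ[R] N, g = r • g' := by
  choose g' hg' using fun x => mem_smul_top_iff.mp (hg x)
  refine ⟨⟨⟨g', fun x y => hr ?_⟩, fun a x => hr ?_⟩, LinearMap.ext fun x => (hg' x).symm⟩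
  · simp [hg']
  · simp [hg', smul_comm r a]

theorem exists_comp_eq_of_ker_le {F W N : Type*} [AddCommGroup F] [Module R F] [AddCommGroup W]
    [Module R W] [AddCommGroup N] [Module R N] {p : F →ₗ[R] W} (hp : Function.Surjective p)
    {g : F →ₗ[R] N} (hle : LinearMap.ker p ≤ LinearMap.ker g) : ∃ φ : W →ₗ[R] N, φ ∘ₗ p = g := by
  refine ⟨(LinearMap.ker p).liftQ _ hle ∘ₗ (p.quotKerEquivOfSurjective hp).symm.toLinearMap, ?_⟩
  ext x
  have : (p.quotKerEquivOfSurjective hp).symm (p x) = Submodule.Quotient.mk x := by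
    rw [LinearEquiv.symm_apply_eq]; rfl
  simp [this]

theorem eq_top_of_forall_exists_sub_smul [IsLocalRing R] {M : Type*} [AddCommGroup M] [Module R M]
    [Module.Finite R M] {r : R} (hr : r ∈ maximalIdeal R) (N : Submodule R M)
    (h : ∀ x : M, ∃ n ∈ N, ∃ y, x = n + r • y) : N = ⊤ := by
  refine top_le_iff.mp (le_of_le_smul_of_le_jacobson_bot (I := maximalIdeal R)
    Module.Finite.fg_top (by rw [jacobson_eq_maximalIdeal ⊥ bot_ne_top]) fun x _ => ?_)
  obtain ⟨n, hn, y, rfl⟩ := h x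
  exact add_mem (mem_sup_left hn) (mem_sup_right (smul_mem_smul hr mem_top))

/-- Every linear map from the submodule `K` of `F` to `N` extends to `F`. -/
def ExtendsTo {F : Type*} [AddCommGroup F] [Module R F] (K : Submodule R F)
    (N : Type*) [AddCommGroup N] [Module R N] : Prop :=
  ∀ h : K →ₗ[R] N, ∃ H : F →ₗ[R] N, H ∘ₗ K.subtype = h

variable {F W N N' : Type*} [AddCommGroup F] [Module R F] [AddCommGroup W] [Module R W]
  [AddCommGroup N] [Module R N] [AddCommGroup N'] [Module R N']

theorem ExtendsTo.congr {K : Submodule R F} (e : N ≃ₗ[R] N') (h : ExtendsTo K N) :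
    ExtendsTo K N' := fun g => by
  obtain ⟨H, hH⟩ := h (e.symm.toLinearMap ∘ₗ g)
  refine ⟨e.toLinearMap ∘ₗ H, ?_⟩
  rw [LinearMap.comp_assoc, hH]
  ext x; simp

theorem ExtendsTo.of_quotSMulTop [IsLocalRing R] [IsNoetherianRing R] [Module.Finite R F]
    [Module.Projective R F] [Module.Finite R N] {K : Submodule R F} {r : R}
    (hm : r ∈ maximalIdeal R) (hr : IsSMulRegular N r) (h : ExtendsTo K (QuotSMulTop r N)) :
    ExtendsTo K N := by
  have : Module.Finite R (K →ₗ[R] N) := inferInstance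
  have key : LinearMap.range (LinearMap.lcomp R N K.subtype) = ⊤ := by
    refine eq_top_of_forall_exists_sub_smul hm _ fun g => ?_
    obtain ⟨H, hH⟩ := h ((r • ⊤ : Submodule R N).mkQ ∘ₗ g)
    obtain ⟨H', hH'⟩ := Module.projective_lifting_property (r • ⊤ : Submodule R N).mkQ H
      (mkQ_surjective _)
    obtain ⟨g', hg'⟩ := exists_smul_eq_of_forall_mem hr (g - H' ∘ₗ K.subtype) fun x => by
      rw [← Submodule.Quotient.mk_eq_zero]
      have h1 := LinearMap.congr_fun hH x
      rw [← hH'] at h1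
      simp only [LinearMap.comp_apply, mkQ_apply, subtype_apply] at h1
      simp [h1]
    exact ⟨_, ⟨H', rfl⟩, g', by rw [← hg']; ext; simp⟩
  intro g
  obtain ⟨H, hH⟩ := (key ▸ mem_top : g ∈ LinearMap.range (LinearMap.lcomp R N K.subtype))
  exact ⟨H, hH⟩

theorem ExtendsTo.exists_lift [Module.Projective R F] {p : F →ₗ[R] W}
    (hp : Function.Surjective p) {r : R} (hr : IsSMulRegular N r)
    (h : ExtendsTo (LinearMap.ker p) N) (φ : W →ₗ[R] QuotSMulTop r N) :
    ∃ Φ : W →ₗ[R] N, (r • ⊤ : Submodule R N).mkQ ∘ₗ Φ = φ := by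
  obtain ⟨G, hG⟩ := Module.projective_lifting_property (r • ⊤ : Submodule R N).mkQ (φ ∘ₗ p)
    (mkQ_surjective _)
  have hG' : ∀ x, Submodule.Quotient.mk (G x) = φ (p x) := fun x => LinearMap.congr_fun hG x
  obtain ⟨g, hg⟩ := exists_smul_eq_of_forall_mem hr (G ∘ₗ (LinearMap.ker p).subtype) fun x => by
    rw [← Submodule.Quotient.mk_eq_zero]
    simp [hG']
  obtain ⟨H, hH⟩ := h g
  obtain ⟨Φ, hΦ⟩ : ∃ Φ : W →ₗ[R] N, Φ ∘ₗ p = G - r • H := by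
    have hle : LinearMap.ker p ≤ LinearMap.ker (G - r • H) := fun x hx => by
      have h1 := LinearMap.congr_fun hg ⟨x, hx⟩
      have h2 := LinearMap.congr_fun hH ⟨x, hx⟩
      simp only [LinearMap.comp_apply, subtype_apply, LinearMap.smul_apply] at h1 h2
      simp [h1, h2]
    exact exists_comp_eq_of_ker_le hp hle
  refine ⟨Φ, LinearMap.ext fun w => ?_⟩
  obtain ⟨x, rfl⟩ := hp w
  have h1 := LinearMap.congr_fun hΦ x
  simp only [LinearMap.comp_apply] at h1 ⊢
  rw [h1, ← hG' x]
  rw [mkQ_apply, Submodule.Quotient.eq]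
  exact mem_smul_top_iff.mpr ⟨-H x, by simp⟩

/-- If extension problems along `ker p` are solvable modulo `rs`, then they are solvable, and maps
from the target of `p` lift modulo `rs`. -/
theorem ExtendsTo.of_isWeaklyRegular [IsLocalRing R] [IsNoetherianRing R] [Module.Finite R F]
    [Module.Projective R F] {p : F →ₗ[R] W} (hp : Function.Surjective p) (rs : List R)
    (hm : ∀ r ∈ rs, r ∈ maximalIdeal R) :
    ∀ (N : Type) [AddCommGroup N] [Module R N] [Module.Finite R N], IsWeaklyRegular N rs →
      ExtendsTo (LinearMap.ker p) (N ⧸ (Ideal.ofList rs • ⊤ : Submodule R N)) →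
      ExtendsTo (LinearMap.ker p) N ∧
        ∀ φ : W →ₗ[R] N ⧸ (Ideal.ofList rs • ⊤ : Submodule R N),
          ∃ Φ : W →ₗ[R] N, mkQ _ ∘ₗ Φ = φ := by
  induction rs with
  | nil =>
    intro N _ _ _ _ h
    let e := quotOfListNilEquiv R N
    exact ⟨h.congr e, fun φ => ⟨e.toLinearMap ∘ₗ φ, LinearMap.ext fun w => e.injective rfl⟩⟩
  | cons r rs ih =>
    intro N _ _ _ hreg h
    rw [isWeaklyRegular_cons_iff] at hreg
    let e := quotOfListConsSMulTopEquivQuotSMulTopInner N r rs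
    have hrm := hm r (by simp)
    obtain ⟨h1, h2⟩ := ih (fun x hx => hm x (by simp [hx])) (QuotSMulTop r N) hreg.2 (h.congr e)
    have h3 := h1.of_quotSMulTop hrm hreg.1
    refine ⟨h3, fun φ => ?_⟩
    obtain ⟨φ', hφ'⟩ := h2 (e.toLinearMap ∘ₗ φ)
    obtain ⟨Φ, rfl⟩ := h3.exists_lift hp hreg.1 φ'
    refine ⟨Φ, LinearMap.ext fun w => e.injective ?_⟩
    exact LinearMap.congr_fun hφ' w

/-- If every endomorphism of `M / (rs) M` is a homothety, so is every endomorphism of `M`. -/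
theorem exists_eq_smul_of_isWeaklyRegular [IsLocalRing R] [IsNoetherianRing R] (rs : List R)
    (hm : ∀ r ∈ rs, r ∈ maximalIdeal R) :
    ∀ (M : Type) [AddCommGroup M] [Module R M] [Module.Finite R M], IsWeaklyRegular M rs →
      (∀ g : Module.End R (M ⧸ (Ideal.ofList rs • ⊤ : Submodule R M)), ∃ a : R, ∀ x, g x = a • x) →
      ∀ g : Module.End R M, ∃ a : R, ∀ x, g x = a • x := by
  induction rs with
  | nil =>
    intro M _ _ _ _ h g
    let e := quotOfListNilEquiv R M
    obtain ⟨a, ha⟩ := h (e.symm.toLinearMap ∘ₗ g ∘ₗ e.toLinearMap)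
    refine ⟨a, fun x => e.symm.injective ?_⟩
    simpa using ha (e.symm x)
  | cons r rs ih =>
    intro M _ _ _ hreg h g
    rw [isWeaklyRegular_cons_iff] at hreg
    let e := quotOfListConsSMulTopEquivQuotSMulTopInner M r rs
    have ih' := ih (fun x hx => hm x (by simp [hx])) (QuotSMulTop r M) hreg.2 (fun g => by
      obtain ⟨a, ha⟩ := h (e.symm.toLinearMap ∘ₗ g ∘ₗ e.toLinearMap)
      refine ⟨a, fun x => e.symm.injective ?_⟩
      simpa using ha (e.symm x))
    have key : LinearMap.range (LinearMap.toSpanSingleton R (Module.End R M) 1) = ⊤ := by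
      refine eq_top_of_forall_exists_sub_smul (hm r (by simp)) _ fun g => ?_
      obtain ⟨a, ha⟩ := ih' (QuotSMulTop.map r g)
      obtain ⟨g', hg'⟩ := exists_smul_eq_of_forall_mem hreg.1 (g - a • 1) fun x => by
        rw [← Submodule.Quotient.mk_eq_zero]
        simpa [sub_eq_zero] using ha (Submodule.Quotient.mk x)
      exact ⟨a • 1, ⟨a, rfl⟩, g', by rw [← hg']; simp⟩
    obtain ⟨a, ha⟩ := (key ▸ mem_top :
      g ∈ LinearMap.range (LinearMap.toSpanSingleton R (Module.End R M) 1))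
    exact ⟨a, fun x => by rw [← ha]; simp⟩

/-- The annihilator of `M` is `J` if the annihilator of `M / (rs) M` is `J + (rs)`. -/
theorem mem_of_smul_eq_zero_of_isWeaklyRegular [IsLocalRing R] [IsNoetherianRing R] (rs : List R)
    (hm : ∀ r ∈ rs, r ∈ maximalIdeal R) :
    ∀ (M : Type) [AddCommGroup M] [Module R M] (J : Ideal R), IsWeaklyRegular M rs →
      (∀ a ∈ J, ∀ x : M, a • x = 0) →
      (∀ a : R, (∀ x : M ⧸ (Ideal.ofList rs • ⊤ : Submodule R M), a • x = 0) →
        a ∈ J ⊔ Ideal.ofList rs) →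
      ∀ a : R, (∀ x : M, a • x = 0) → a ∈ J := by
  induction rs with
  | nil =>
    intro M _ _ J _ _ h a ha
    let e := quotOfListNilEquiv R M
    simpa using h a fun x => e.injective (by simpa using ha (e x))
  | cons r rs ih =>
    intro M _ _ J hreg hJ h a ha
    rw [isWeaklyRegular_cons_iff] at hreg
    let e := quotOfListConsSMulTopEquivQuotSMulTopInner M r rs
    have ih' := ih (fun x hx => hm x (by simp [hx])) (QuotSMulTop r M) (J ⊔ Ideal.span {r}) hreg.2
      (fun a ha x => by
        obtain ⟨x, rfl⟩ := Submodule.Quotient.mk_surjective _ x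
        obtain ⟨j, hj, b, hb, rfl⟩ := Submodule.mem_sup.mp ha
        obtain ⟨c, rfl⟩ := Ideal.mem_span_singleton'.mp hb
        rw [← Submodule.Quotient.mk_smul, Submodule.Quotient.mk_eq_zero, add_smul, hJ j hj,
          zero_add]
        exact mem_smul_top_iff.mpr ⟨c • x, by rw [smul_smul, mul_comm]⟩)
      (fun a ha => by
        have := h a fun x => e.injective (by simpa using ha (e x))
        rwa [Ideal.ofList_cons, ← sup_assoc] at this)
    let K : Ideal R := Module.annihilator R M
    have hK : K ≤ J ⊔ maximalIdeal R • K := fun x hx => by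
      have hx' := Module.mem_annihilator.mp hx
      obtain ⟨j, hj, b, hb, rfl⟩ := Submodule.mem_sup.mp (ih' x fun y => by
        obtain ⟨y, rfl⟩ := Submodule.Quotient.mk_surjective _ y
        rw [← Submodule.Quotient.mk_smul, hx', Submodule.Quotient.mk_zero])
      obtain ⟨c, rfl⟩ := Ideal.mem_span_singleton'.mp hb
      refine add_mem (mem_sup_left hj) (mem_sup_right ?_)
      rw [mul_comm]
      refine smul_mem_smul (hm r (by simp)) (Module.mem_annihilator.mpr fun y => hreg.1 ?_)
      have := hx' y
      rw [add_smul, hJ j hj, zero_add, mul_comm, mul_smul] at this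
      simpa using this
    exact le_of_le_smul_of_le_jacobson_bot (IsNoetherian.noetherian K)
      (by rw [jacobson_eq_maximalIdeal ⊥ bot_ne_top]) hK (Module.mem_annihilator.mpr ha)

/-- If every endomorphism of the faithful module `M` over a reduced ring is a homothety, then
linear forms on `M` satisfy `φ u • v = φ v • u`. -/
theorem apply_smul_comm_of_isReduced [IsReduced R] {M : Type*} [AddCommGroup M] [Module R M]
    (hend : ∀ g : Module.End R M, ∃ a : R, ∀ x, g x = a • x)
    (hfaith : ∀ a : R, (∀ x : M, a • x = 0) → a = 0) (φ : M →ₗ[R] R) (u v : M) :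
    φ u • v = φ v • u := by
  obtain ⟨a, ha⟩ := hend (φ.smulRight v)
  simp only [LinearMap.smulRight_apply] at ha
  have hφ : ∀ w, (a - φ v) * φ w = 0 := fun w => by
    have := congrArg φ (ha w)
    simp only [map_smul, smul_eq_mul] at this
    rw [sub_mul, ← this]; ring
  have hv : (a - φ v) • v = 0 := by rw [sub_smul, ← ha, sub_self]
  have hsq : (a - φ v) ^ 2 = 0 := hfaith _ fun w => by
    have h1 : (a - φ v) • w = φ w • v - φ v • w := by rw [sub_smul, ← ha]
    rw [pow_two, mul_smul, h1, smul_sub, smul_comm, hv, smul_zero, smul_smul, hφ]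
    simp
  have hc : a = φ v := sub_eq_zero.mp (pow_eq_zero_iff two_ne_zero |>.mp hsq)
  rw [ha u, hc]

end Nakayama

section Coregular

variable {R : Type} [CommRing R] {N : Type} [AddCommGroup N] [Module R N]

/-- The elements of `S` killed by all members of the list `rs`. -/
def killedBy (S : Submodule R N) : List R → Submodule R N
  | [] => S
  | r :: rs => killedBy (S ⊓ torsionBy R N r) rs

theorem mem_killedBy {S : Submodule R N} {rs : List R} {x : N} :
    x ∈ killedBy S rs ↔ x ∈ S ∧ ∀ r ∈ rs, r • x = 0 := by
  induction rs generalizing S with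
  | nil => simp [killedBy]
  | cons r rs ih => simp [killedBy, ih, and_assoc]

/-- The dual notion of a weakly regular sequence: each `r` acts surjectively on the elements of `S`
killed by its predecessors. -/
def IsCoregular (S : Submodule R N) : List R → Prop
  | [] => True
  | r :: rs => (∀ x ∈ S, ∃ y ∈ S, r • y = x) ∧ IsCoregular (S ⊓ torsionBy R N r) rs

/-- The inverse limit of `S[r] ← S[r²] ← S[r³] ← ⋯` along multiplication by `r`. -/
def divSeq (r : R) (S : Submodule R N) : Submodule R (ℕ → N) where
  carrier := {s | (∀ i, s i ∈ S) ∧ r • s 0 = 0 ∧ ∀ i, r • s (i + 1) = s i}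
  add_mem' {s t} hs ht := ⟨fun i => add_mem (hs.1 i) (ht.1 i), by simp [hs.2.1, ht.2.1],
    fun i => by simp [hs.2.2, ht.2.2]⟩
  zero_mem' := by simp
  smul_mem' c s hs := ⟨fun i => S.smul_mem c (hs.1 i), by simp [smul_comm r c, hs.2.1],
    fun i => by simp [smul_comm r c, hs.2.2]⟩

theorem mem_divSeq {r : R} {S : Submodule R N} {s : ℕ → N} :
    s ∈ divSeq r S ↔ (∀ i, s i ∈ S) ∧ r • s 0 = 0 ∧ ∀ i, r • s (i + 1) = s i := Iff.rfl

theorem pow_smul_divSeq {r : R} {S : Submodule R N} {s : ℕ → N} (hs : s ∈ divSeq r S) (i : ℕ) :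
    r ^ (i + 1) • s i = 0 := by
  induction i with
  | zero => simpa using hs.2.1
  | succ i ih => rw [pow_succ, mul_smul, hs.2.2, ih]

theorem divSeq_inf_torsionBy (r g : R) (S : Submodule R N) :
    divSeq r S ⊓ torsionBy R (ℕ → N) g = divSeq r (S ⊓ torsionBy R N g) := by
  ext s
  simp only [mem_inf, mem_divSeq, mem_torsionBy_iff, funext_iff, Pi.smul_apply, Pi.zero_apply,
    forall_and]
  tauto

theorem killedBy_divSeq (r : R) (S : Submodule R N) (rs : List R) :
    killedBy (divSeq r S) rs = divSeq r (killedBy S rs) := by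
  induction rs generalizing S with
  | nil => rfl
  | cons g rs ih => rw [killedBy, divSeq_inf_torsionBy, ih, killedBy]

theorem IsCoregular.swap {S : Submodule R N} {r g : R} {rs : List R}
    (h : IsCoregular S (r :: g :: rs)) : IsCoregular (S ⊓ torsionBy R N g) (r :: rs) := by
  obtain ⟨h1, h2, h3⟩ := h
  refine ⟨fun x hx => ?_, by rwa [inf_right_comm]⟩
  simp only [mem_inf, mem_torsionBy_iff] at hx h2 ⊢
  obtain ⟨y, hy, rfl⟩ := h1 x hx.1
  obtain ⟨t, ht, htg⟩ := h2 (g • y) ⟨S.smul_mem g hy, by rw [smul_comm, hx.2]⟩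
  exact ⟨y - t, ⟨S.sub_mem hy ht.1, by rw [smul_sub, htg, sub_self]⟩,
    by rw [smul_sub, ht.2, sub_zero]⟩

theorem IsCoregular.surjOn_killedBy {S : Submodule R N} {r : R} {rs : List R}
    (h : IsCoregular S (r :: rs)) : ∀ x ∈ killedBy S rs, ∃ y ∈ killedBy S rs, r • y = x := by
  induction rs generalizing S with
  | nil => exact h.1
  | cons g rs ih => exact ih h.swap

theorem exists_mem_divSeq {S : Submodule R N} {r : R} (h : ∀ x ∈ S, ∃ y ∈ S, r • y = x) {x : N}
    (hx : x ∈ S) (hrx : r • x = 0) : ∃ s ∈ divSeq r S, s 0 = x := by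
  choose! f hfS hf using h
  have hS : ∀ i, f^[i] x ∈ S := fun i => by
    induction i with
    | zero => exact hx
    | succ i ih => rw [Function.iterate_succ_apply']; exact hfS _ ih
  exact ⟨fun i => f^[i] x, ⟨hS, hrx, fun i => by
    simp only [Function.iterate_succ_apply']; exact hf _ (hS i)⟩, rfl⟩

theorem IsCoregular.surjOn_divSeq {S : Submodule R N} {r g : R} {rs : List R}
    (h : IsCoregular S (r :: g :: rs)) : ∀ s ∈ divSeq r S, ∃ t ∈ divSeq r S, g • t = s := by
  intro s hs
  obtain ⟨h1, h2, -⟩ := h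
  simp only [mem_inf, mem_torsionBy_iff] at h2
  have step : ∀ (i : ℕ) (m : N), m ∈ S → g • m = s i →
      ∃ m' ∈ S, g • m' = s (i + 1) ∧ r • m' = m := fun i m hm hgm => by
    obtain ⟨y, hy, rfl⟩ := h1 m hm
    obtain ⟨t, ht, htg⟩ := h2 (g • y - s (i + 1)) ⟨S.sub_mem (S.smul_mem g hy) (hs.1 _), by
      rw [smul_sub, smul_comm, hgm, hs.2.2, sub_self]⟩
    exact ⟨y - t, S.sub_mem hy ht.1, by rw [smul_sub, htg, sub_sub_cancel],
      by rw [smul_sub, ht.2, sub_zero]⟩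
  obtain ⟨m₀, ⟨hm₀, hrm₀⟩, hg₀⟩ := h2 (s 0) ⟨hs.1 0, hs.2.1⟩
  choose! f hfS hfg hfr using step
  let t : ℕ → N := fun n => Nat.rec m₀ (fun i m => f i m) n
  have ht : ∀ i, t i ∈ S ∧ g • t i = s i := fun i => by
    induction i with
    | zero => exact ⟨hm₀, hg₀⟩
    | succ i ih => exact ⟨hfS i _ ih.1 ih.2, hfg i _ ih.1 ih.2⟩
  exact ⟨t, ⟨fun i => (ht i).1, hrm₀, fun i => hfr i _ (ht i).1 (ht i).2⟩,
    funext fun i => (ht i).2⟩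

theorem IsCoregular.divSeq {S : Submodule R N} {r : R} {rs : List R}
    (h : IsCoregular S (r :: rs)) : IsCoregular (divSeq r S) rs := by
  induction rs generalizing S with
  | nil => trivial
  | cons g rs ih => exact ⟨h.surjOn_divSeq, divSeq_inf_torsionBy r g S ▸ ih h.swap⟩

theorem isSMulRegular_divSeq (r : R) (S : Submodule R N) : IsSMulRegular (divSeq r S) r := by
  rintro ⟨s, hs⟩ ⟨t, ht⟩ h
  refine Subtype.ext (funext fun i => ?_)
  have h1 : r • s (i + 1) = r • t (i + 1) := congrFun (congrArg Subtype.val h) (i + 1)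
  exact (hs.2.2 i).symm.trans (h1.trans (ht.2.2 i))

/-- If `r` acts surjectively on `S`, then `divSeq r S` modulo `r` is the `r`-torsion of `S`. -/
theorem nonempty_quotSMulTop_divSeq_equiv {S : Submodule R N} {r : R}
    (h : ∀ x ∈ S, ∃ y ∈ S, r • y = x) :
    Nonempty (QuotSMulTop r (divSeq r S) ≃ₗ[R] (S ⊓ torsionBy R N r : Submodule R N)) := by
  let p : divSeq r S →ₗ[R] (S ⊓ torsionBy R N r : Submodule R N) :=
    (LinearMap.proj 0 ∘ₗ (divSeq r S).subtype).codRestrict _ fun s => ⟨s.2.1 0, s.2.2.1⟩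
  have hp : Function.Surjective p := fun x => by
    obtain ⟨s, hs, hs0⟩ := exists_mem_divSeq h x.2.1 x.2.2
    exact ⟨⟨s, hs⟩, Subtype.ext hs0⟩
  have hker : (r • ⊤ : Submodule R (divSeq r S)) = LinearMap.ker p := by
    ext s
    constructor
    · intro hs
      obtain ⟨t, -, rfl⟩ := (mem_smul_pointwise_iff_exists _ _ _).mp hs
      exact Subtype.ext t.2.2.1
    · intro hs
      have h0 : s.1 0 = 0 := congrArg Subtype.val hs
      refine (mem_smul_pointwise_iff_exists _ _ _).mpr ⟨⟨fun i => s.1 (i + 1), fun i => s.2.1 _, ?_,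
        fun i => s.2.2.2 _⟩, mem_top, Subtype.ext (funext fun i => s.2.2.2 i)⟩
      exact (s.2.2.2 0).trans h0
  exact ⟨quotEquivOfEq _ _ hker ≪≫ₗ p.quotKerEquivOfSurjective hp⟩

theorem ofList_eq_of_perm {rs rs' : List R} (h : rs.Perm rs') :
    Ideal.ofList rs = Ideal.ofList rs' := by
  simp only [Ideal.ofList, h.mem_iff]

/-- A coregular sequence on `S` is, up to order, weakly regular on some module `M` such that `M`
modulo the sequence is the part of `S` killed by the sequence. -/
theorem exists_isWeaklyRegular_of_isCoregular (rs : List R) :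
    ∀ (N : Type) [AddCommGroup N] [Module R N] (S : Submodule R N), IsCoregular S rs →
      ∃ (M : Type) (_ : AddCommGroup M) (_ : Module R M) (rs' : List R), rs'.Perm rs ∧
        IsWeaklyRegular M rs' ∧
        Nonempty ((M ⧸ (Ideal.ofList rs • ⊤ : Submodule R M)) ≃ₗ[R] killedBy S rs) ∧
        ∀ x : M, x ≠ 0 → ∃ (l : M →ₗ[R] S) (k : ℕ), l x ≠ 0 ∧ ∀ r ∈ rs, ∀ y, l (r ^ k • y) = 0 := by
  induction rs with
  | nil =>
    intro N _ _ S _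
    exact ⟨S, inferInstance, inferInstance, [], .refl _, .nil R S,
      ⟨quotEquivOfEqBot _ ((congrArg (· • ⊤) Ideal.ofList_nil).trans (bot_smul ⊤))⟩,
      fun x hx => ⟨.id, 0, hx, by simp⟩⟩
  | cons r rs ih =>
    intro N _ _ S h
    obtain ⟨M, _, _, rs', hperm, hreg, ⟨e⟩, hsep⟩ := ih (ℕ → N) (divSeq r S) h.divSeq
    have e₁ : (M ⧸ (Ideal.ofList rs • ⊤ : Submodule R M)) ≃ₗ[R]
        DualizingLift.divSeq r (killedBy S rs) :=
      e ≪≫ₗ LinearEquiv.ofEq _ _ (killedBy_divSeq r S rs)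
    obtain ⟨e₂⟩ := nonempty_quotSMulTop_divSeq_equiv h.surjOn_killedBy
    have e₃ : (killedBy S rs ⊓ torsionBy R N r : Submodule R N) = killedBy S (r :: rs) := by
      ext x
      simp only [mem_inf, mem_killedBy, mem_torsionBy_iff, List.forall_mem_cons]
      tauto
    refine ⟨M, inferInstance, inferInstance, rs' ++ [r], ?_, ?_, ⟨?_⟩, ?_⟩
    · exact List.perm_append_comm.trans (by simpa using hperm)
    · rw [isWeaklyRegular_append_iff, isWeaklyRegular_singleton_iff, ofList_eq_of_perm hperm]
      exact ⟨hreg, (e₁.isSMulRegular_congr r).mpr (isSMulRegular_divSeq r _)⟩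
    · exact quotOfListConsSMulTopEquivQuotSMulTopOuter M r rs ≪≫ₗ QuotSMulTop.congr r e₁ ≪≫ₗ e₂ ≪≫ₗ
        LinearEquiv.ofEq _ _ e₃
    · intro x hx
      obtain ⟨l, k, hl, hk⟩ := hsep x hx
      obtain ⟨i, hi⟩ : ∃ i, (l x).1 i ≠ 0 := by
        by_contra! hc
        exact hl (Subtype.ext (funext hc))
      let p : DualizingLift.divSeq r S →ₗ[R] S :=
        (LinearMap.proj i ∘ₗ (DualizingLift.divSeq r S).subtype).codRestrict _ fun s => s.2.1 i
      refine ⟨p ∘ₗ l, k + (i + 1), fun hc => hi (congrArg Subtype.val hc), ?_⟩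
      intro a ha y
      rcases List.mem_cons.mp ha with rfl | ha
      · have hs := pow_smul_divSeq (l (a ^ k • y)).2 i
        rw [add_comm, pow_add, mul_smul, map_smul]
        exact Subtype.ext hs
      · rw [pow_add, mul_smul, LinearMap.comp_apply, hk a ha, map_zero]

/-- A weakly regular sequence on the ring is coregular on injective modules. -/
theorem isCoregular_of_injective [Module.Injective R N] (rs : List R) : ∀ rs₀ : List R,
    IsWeaklyRegular R (rs₀ ++ rs) → IsCoregular (killedBy (⊤ : Submodule R N) rs₀) rs := by
  induction rs with
  | nil => exact fun _ _ => trivial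
  | cons r rs ih =>
    intro rs₀ h
    refine ⟨fun x hx => ?_, ?_⟩
    · obtain ⟨-, h2⟩ := (isWeaklyRegular_append_iff _ _ _).mp h
      have hr := ((isWeaklyRegular_cons_iff _ _ _).mp h2).1
      let J : Ideal R := Ideal.ofList rs₀ • ⊤
      have hJ : J ≤ LinearMap.ker (LinearMap.toSpanSingleton R N x) := by
        simp only [J, smul_eq_mul, Ideal.mul_top]
        exact Ideal.span_le.mpr fun a ha => by simpa using (mem_killedBy.mp hx).2 a ha
      obtain ⟨g, hg⟩ := Module.Injective.out (LinearMap.lsmul R (R ⧸ J) r) hr (J.liftQ _ hJ)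
      refine ⟨g (Submodule.Quotient.mk 1), mem_killedBy.mpr ⟨mem_top, fun a ha => ?_⟩, ?_⟩
      · rw [← map_smul, ← Submodule.Quotient.mk_smul, (Submodule.Quotient.mk_eq_zero _).mpr,
          map_zero]
        simp only [J, smul_eq_mul, Ideal.mul_top, mul_one]
        exact Ideal.subset_span ha
      · rw [← map_smul]
        exact (hg (Submodule.Quotient.mk 1)).trans (one_smul R x)
    · have := ih (rs₀ ++ [r]) (by simpa using h)
      convert this using 1
      ext x
      simp only [mem_inf, mem_killedBy, mem_torsionBy_iff, List.mem_append, List.mem_singleton]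
      exact ⟨fun h => ⟨h.1.1, fun a ha => ha.elim (h.1.2 a) (fun e => e ▸ h.2)⟩,
        fun h => ⟨⟨h.1, fun a ha => h.2 a (.inl ha)⟩, h.2 r (.inr rfl)⟩⟩

end Coregular

section Hull

variable {R : Type} [CommRing R] {J : Type} [AddCommGroup J] [Module R J]

theorem exists_le_maximal_disjoint {C W : Submodule R J} (h : Disjoint C W) :
    ∃ N, C ≤ N ∧ Disjoint N W ∧ ∀ N', N ≤ N' → Disjoint N' W → N' ≤ N := by
  obtain ⟨N, hCN, hN⟩ := zorn_le_nonempty₀ {N : Submodule R J | Disjoint W N}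
    (fun c hc hchain y hy =>
    ⟨sSup c, (hchain.directedOn.disjoint_sSup_right).mpr fun b hb => hc hb,
      fun z hz => le_sSup hz⟩) C h.symm
  exact ⟨N, hCN, hN.1.symm, fun N' h1 h2 => hN.2 h2.symm h1⟩

/-- In an injective module, mutual relative complements are complements. -/
theorem isCompl_of_maximal_disjoint [Module.Injective R J] {E N : Submodule R J}
    (hd : Disjoint E N) (hE : ∀ E', E ≤ E' → Disjoint E' N → E' ≤ E)
    (hN : ∀ N', N ≤ N' → Disjoint N' E → N' ≤ N) : IsCompl E N := by
  have hinj : Function.Injective (N.mkQ ∘ₗ E.subtype) := by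
    rw [← LinearMap.ker_eq_bot, LinearMap.ker_comp, ker_mkQ, ← disjoint_iff_comap_eq_bot]
    exact hd
  obtain ⟨ψ, hψ⟩ := Module.Injective.out (N.mkQ ∘ₗ E.subtype) hinj E.subtype
  have hψE : ∀ e ∈ E, ψ (N.mkQ e) = e := fun e he => hψ ⟨e, he⟩
  have hψN : ∀ n ∈ N, N.mkQ n = 0 := fun n hn => by simpa using hn
  have hle : N.comap (ψ ∘ₗ N.mkQ) ≤ N := by
    refine hN _ (fun n hn => ?_) (disjoint_def.mpr fun e he heE => ?_)
    · rw [mem_comap, LinearMap.comp_apply, hψN n hn, map_zero]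
      exact zero_mem _
    · rw [mem_comap, LinearMap.comp_apply, hψE e heE] at he
      exact disjoint_def.mp hd e heE he
  have hrange : LinearMap.range (ψ ∘ₗ N.mkQ) ≤ E := by
    refine hE _ (fun e he => ⟨e, hψE e he⟩) (disjoint_def.mpr ?_)
    rintro _ ⟨y, rfl⟩ hy
    rw [LinearMap.comp_apply, hψN y (hle hy), map_zero]
  refine ⟨hd, codisjoint_iff.mpr (top_le_iff.mp fun y _ => ?_)⟩
  have he : ψ (N.mkQ y) ∈ E := hrange ⟨y, rfl⟩
  have hn : y - ψ (N.mkQ y) ∈ N := hle (by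
    rw [mem_comap, LinearMap.comp_apply, map_sub, map_sub, hψE _ he, sub_self]
    exact zero_mem _)
  exact mem_sup.mpr ⟨_, he, _, hn, by abel⟩

theorem injective_of_isCompl [Module.Injective R J] {E N : Submodule R J} (h : IsCompl E N) :
    Module.Injective R E := by
  refine ⟨fun X Y _ _ _ _ i hi g => ?_⟩
  obtain ⟨H, hH⟩ := Module.Injective.out i hi (E.subtype ∘ₗ g)
  exact ⟨E.projectionOnto N h ∘ₗ H, fun x => by simp [hH]⟩

/-- If `W` is a direct summand of every module killed by `rs` which contains it, then `W` is the
part killed by `rs` of an injective module. -/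
theorem exists_injective_killedBy_equiv (rs : List R) (W : Type) [AddCommGroup W] [Module R W]
    (hW : ∀ r ∈ rs, ∀ w : W, r • w = 0)
    (hret : ∀ (X : Type) [AddCommGroup X] [Module R X], (∀ r ∈ rs, ∀ x : X, r • x = 0) →
      ∀ i : W →ₗ[R] X, Function.Injective i → ∃ ρ : X →ₗ[R] W, ∀ w, ρ (i w) = w) :
    ∃ (E : Type) (_ : AddCommGroup E) (_ : Module R E), Module.Injective R E ∧
      Nonempty (killedBy (⊤ : Submodule R E) rs ≃ₗ[R] W) := by
  let J := Injective.under (ModuleCat.of R W)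
  have : Module.Injective R J := 
    (Module.injective_iff_injective_object R J).mpr
      (Injective.injective_under (ModuleCat.of R W))
  let j : W →ₗ[R] J := (Injective.ι (ModuleCat.of R W)).hom
  have hj : Function.Injective j := (ModuleCat.mono_iff_injective _).mp inferInstance
  let T := killedBy (⊤ : Submodule R J) rs
  let i : W →ₗ[R] T := j.codRestrict T fun w =>
    mem_killedBy.mpr ⟨mem_top, fun r hr => by rw [← map_smul, hW r hr, map_zero]⟩
  obtain ⟨ρ, hρ⟩ := hret T (fun r hr x => Subtype.ext ((mem_killedBy.mp x.2).2 r hr)) i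
    fun a b h => hj (congrArg Subtype.val h)
  have hdisj : Disjoint ((LinearMap.ker ρ).map T.subtype) (LinearMap.range j) := by
    rw [disjoint_def]
    rintro _ ⟨t, ht, rfl⟩ ⟨w, hw⟩
    have : i w = t := Subtype.ext hw
    subst this
    have h0 : w = 0 := (hρ w).symm.trans ht
    simp [h0]
  obtain ⟨N, hCN, hNW, hNmax⟩ := exists_le_maximal_disjoint hdisj
  obtain ⟨E, hWE, hEN, hEmax⟩ := exists_le_maximal_disjoint hNW.symm
  have hc : IsCompl E N := isCompl_of_maximal_disjoint hEN hEmax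
    fun N' h1 h2 => hNmax N' h1 (h2.mono_right hWE)
  refine ⟨E, inferInstance, inferInstance, injective_of_isCompl hc, ⟨?_⟩⟩
  let i' : W →ₗ[R] killedBy (⊤ : Submodule R E) rs :=
    (j.codRestrict E fun w => hWE ⟨w, rfl⟩).codRestrict _ fun w =>
      mem_killedBy.mpr ⟨mem_top, fun r hr => by rw [← map_smul, hW r hr, map_zero]⟩
  refine (LinearEquiv.ofBijective i' ⟨fun a b h => hj (congrArg (fun x => x.1.1) h), ?_⟩).symm
  rintro ⟨⟨x, hxE⟩, hx⟩
  have hxT : x ∈ T := mem_killedBy.mpr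
    ⟨mem_top, fun r hr => congrArg Subtype.val ((mem_killedBy.mp hx).2 r hr)⟩
  let t : T := ⟨x, hxT⟩
  have hN : x - j (ρ t) ∈ N := hCN ⟨t - i (ρ t), by simp [hρ], rfl⟩
  have hz := disjoint_def.mp hEN _ (E.sub_mem hxE (hWE ⟨ρ t, rfl⟩)) hN
  exact ⟨ρ t, Subtype.ext (Subtype.ext (sub_eq_zero.mp hz).symm)⟩

end Hull

section Finiteness

variable {R : Type} [CommRing R]

theorem mem_smul_top_pi_iff {ι : Type*} [Finite ι] (J : Ideal R) (x : ι → R) :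
    x ∈ (J • ⊤ : Submodule R (ι → R)) ↔ ∀ i, x i ∈ J := by
  classical
  have := Fintype.ofFinite ι
  refine ⟨fun hx i => ?_, fun h => ?_⟩
  · refine smul_induction_on hx (fun a ha y _ => ?_) fun y z hy hz => add_mem hy hz
    exact J.mul_mem_right _ ha
  · rw [pi_eq_sum_univ x]
    exact sum_mem fun i _ => smul_mem_smul (h i) mem_top

instance isPrecomplete_pi {ι : Type*} [Finite ι] (J : Ideal R) [IsPrecomplete J R] :
    IsPrecomplete J (ι → R) := by
  refine ⟨fun f hf => ?_⟩
  simp only [SModEq.sub_mem, mem_smul_top_pi_iff] at hf ⊢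
  choose L hL using fun i => IsPrecomplete.prec (I := J) inferInstance (f := fun n => f n i)
    fun h => by simpa [SModEq.sub_mem] using hf h i
  exact ⟨L, fun n i => by simpa [SModEq.sub_mem] using hL i n⟩

/-- A module over a complete noetherian local ring is finite if it is finite modulo a sequence `rs`
generating a primary ideal and is separated by linear maps killed by powers of `rs`. -/
theorem finite_of_finite_quotient [IsLocalRing R] [IsNoetherianRing R]
    [IsAdicComplete (maximalIdeal R) R] (rs : List R) (hm : ∀ r ∈ rs, r ∈ maximalIdeal R)
    (hrad : maximalIdeal R ≤ (Ideal.ofList rs).radical)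
    {M S : Type} [AddCommGroup M] [Module R M] [AddCommGroup S] [Module R S]
    (hsep : ∀ x : M, x ≠ 0 → ∃ (l : M →ₗ[R] S) (k : ℕ), l x ≠ 0 ∧ ∀ r ∈ rs, ∀ y, l (r ^ k • y) = 0)
    [Module.Finite R (M ⧸ (Ideal.ofList rs • ⊤ : Submodule R M))] : Module.Finite R M := by
  have : IsHausdorff (maximalIdeal R) M := by
    refine ⟨fun x hx => by_contra fun hne => ?_⟩
    obtain ⟨l, k, hl, hk⟩ := hsep x hne
    let J : Ideal R := Module.annihilator R (LinearMap.range l)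
    have hJ : Ideal.ofList rs ≤ J.radical := Ideal.span_le.mpr fun r hr =>
      ⟨k, Module.mem_annihilator.mpr fun ⟨_, y, hy⟩ =>
        Subtype.ext (by simp [← hy, ← map_smul, hk r hr])⟩
    obtain ⟨n, hn⟩ := J.exists_radical_pow_le_of_fg (IsNoetherian.noetherian _)
    have hle : maximalIdeal R ≤ J.radical := hrad.trans (Ideal.radical_le_radical_iff.mpr hJ)
    refine hl (smul_induction_on (SModEq.zero.mp (hx n)) (fun a ha y _ => ?_)
      fun y z hy hz => by rw [map_add, hy, hz, add_zero])
    rw [map_smul]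
    exact congrArg Subtype.val (Module.mem_annihilator.mp (hn (Ideal.pow_right_mono hle n ha))
      ⟨l y, y, rfl⟩)
  obtain ⟨n, g, hg⟩ := Module.Finite.exists_fin' R (M ⧸ (Ideal.ofList rs • ⊤ : Submodule R M))
  obtain ⟨p, hp⟩ := Module.projective_lifting_property (Ideal.ofList rs • ⊤ : Submodule R M).mkQ g
    (mkQ_surjective _)
  have hle : (Ideal.ofList rs • ⊤ : Submodule R M) ≤ maximalIdeal R • ⊤ :=
    smul_mono_left (Ideal.span_le.mpr hm)
  refine Module.Finite.of_surjective p (surjective_of_mkQ_comp_surjective (I := maximalIdeal R) ?_)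
  intro y
  obtain ⟨y, rfl⟩ := mkQ_surjective _ y
  obtain ⟨x, hx⟩ := hg (mkQ _ y)
  refine ⟨x, ?_⟩
  rw [← hp] at hx
  rw [LinearMap.comp_apply, mkQ_apply, mkQ_apply, Submodule.Quotient.eq] at hx ⊢
  exact hle hx

end Finiteness

section Cyclic

theorem exists_ne_zero_forall_mul_eq_zero (A : Type) [CommRing A] [IsLocalRing A]
    [IsArtinianRing A] : ∃ t : A, t ≠ 0 ∧ ∀ a ∈ maximalIdeal A, a * t = 0 := by
  classical
  have hnil := (isArtinianRing_iff_isNilpotent_maximalIdeal A).mp inferInstance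
  obtain ⟨n, hn⟩ : ∃ n, Nat.find hnil = n + 1 := Nat.exists_eq_succ_of_ne_zero fun h0 => by
    have := Nat.find_spec hnil
    rw [h0, pow_zero] at this
    exact one_ne_zero this
  have hzero : maximalIdeal A ^ (n + 1) = 0 := hn ▸ Nat.find_spec hnil
  obtain ⟨t, ht, ht0⟩ := exists_mem_ne_zero_of_ne_bot (Nat.find_min hnil (by lia : n < _))
  refine ⟨t, ht0, fun a ha => ?_⟩
  have : a * t ∈ maximalIdeal A ^ (n + 1) := by
    rw [pow_succ']
    exact Ideal.mul_mem_mul ha ht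
  simpa [hzero] using this

/-- A finite faithful module over an artinian local ring is free of rank one if all linear forms on
it satisfy `φ u • v = φ v • u`. -/
theorem nonempty_equiv_of_apply_smul_comm {A : Type} [CommRing A] [IsLocalRing A]
    [IsArtinianRing A] {M : Type*} [AddCommGroup M] [Module A M] [Module.Finite A M]
    (hfaith : ∀ a : A, (∀ x : M, a • x = 0) → a = 0)
    (hcomm : ∀ (φ : M →ₗ[A] A) (u v : M), φ u • v = φ v • u) : Nonempty (A ≃ₗ[A] M) := by
  obtain ⟨t, ht0, ht⟩ := exists_ne_zero_forall_mul_eq_zero A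
  obtain ⟨v, hv⟩ : ∃ v : M, t • v ≠ 0 := by
    by_contra! hc
    exact ht0 (hfaith t hc)
  have htop : span A {v} ⊔ maximalIdeal A • (⊤ : Submodule A M) = ⊤ := by
    refine (eq_top_or_exists_le_coatom _).resolve_right ?_
    rintro ⟨N, hN, hle⟩
    obtain ⟨I, hI, ⟨e⟩⟩ := isSimpleModule_iff_quot_maximal.mp (isSimpleModule_iff_isCoatom.mpr hN)
    have hIt : I ≤ LinearMap.ker (LinearMap.toSpanSingleton A A t) := fun a ha =>
      ht a (eq_maximalIdeal hI ▸ ha)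
    let φ : M →ₗ[A] A := I.liftQ _ hIt ∘ₗ e.toLinearMap ∘ₗ N.mkQ
    obtain ⟨u, hu⟩ := (e.surjective.comp N.mkQ_surjective) (Submodule.Quotient.mk 1)
    have hφu : φ u = t := by
      change I.liftQ _ hIt (e (N.mkQ u)) = t
      rw [show e (N.mkQ u) = Submodule.Quotient.mk 1 from hu, liftQ_apply]
      simp
    have hφv : φ v = 0 := by
      have : N.mkQ v = 0 := by simpa using hle (mem_sup_left (mem_span_singleton_self v))
      simp only [φ, LinearMap.comp_apply, this, map_zero]
    exact hv (by rw [← hφu, hcomm φ u v, hφv, zero_smul])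
  have hspan : span A {v} = ⊤ := top_le_iff.mp <|
    le_of_le_smul_of_le_jacobson_bot (I := maximalIdeal A) Module.Finite.fg_top
      (by rw [jacobson_eq_maximalIdeal ⊥ bot_ne_top]) htop.ge
  have hsurj : ∀ x : M, ∃ a : A, a • v = x := fun x => mem_span_singleton.mp (hspan ▸ mem_top)
  refine ⟨LinearEquiv.ofBijective (LinearMap.toSpanSingleton A M v) ⟨?_, hsurj⟩⟩
  refine (injective_iff_map_eq_zero _).mpr fun a ha => hfaith a fun x => ?_
  obtain ⟨b, rfl⟩ := hsurj x
  rw [LinearMap.toSpanSingleton_apply] at ha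
  rw [smul_comm, ha, smul_zero]

end Cyclic

section Dual

variable {k A : Type} [Field k] [CommRing A] [Algebra k A]

theorem dual_smul_apply (a : A) (φ : A →ₗ[k] k) (x : A) : (a • φ) x = φ (a * x) := rfl

instance isScalarTower_dual : IsScalarTower k A (A →ₗ[k] k) :=
  ⟨fun c a φ => LinearMap.ext fun x => by
    rw [dual_smul_apply, LinearMap.smul_apply, dual_smul_apply, smul_mul_assoc, map_smul]⟩

instance injective_dual : Module.Injective A (A →ₗ[k] k) := by
  refine ⟨fun X Y _ _ _ _ i hi g => ?_⟩
  let _ : Module k X := Module.compHom X (algebraMap k A)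
  let _ : Module k Y := Module.compHom Y (algebraMap k A)
  have : IsScalarTower k A X := .of_algebraMap_smul fun _ _ => rfl
  have : IsScalarTower k A Y := .of_algebraMap_smul fun _ _ => rfl
  obtain ⟨s, hs⟩ := (i.restrictScalars k).exists_leftInverse_of_injective
    (LinearMap.ker_eq_bot.mpr hi)
  let γ : Y →ₗ[k] k := LinearMap.applyₗ (1 : A) ∘ₗ g.restrictScalars k ∘ₗ s
  have hγ : ∀ x, γ (i x) = g x 1 := fun x => congrArg (fun x => g x 1) (LinearMap.congr_fun hs x)
  let G : Y →ₗ[A] (A →ₗ[k] k) :=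
    { toFun y := γ ∘ₗ (LinearMap.toSpanSingleton A Y y).restrictScalars k
      map_add' y z := LinearMap.ext fun a => by simp
      map_smul' b y := LinearMap.ext fun a => by
        simp [dual_smul_apply, smul_smul, mul_comm] }
  refine ⟨G, fun x => LinearMap.ext fun a => ?_⟩
  change γ (a • i x) = g x a
  rw [← map_smul, hγ, map_smul, dual_smul_apply, mul_one]

variable [FiniteDimensional k A]

instance finite_dual : Module.Finite A (A →ₗ[k] k) := Module.Finite.of_restrictScalars_finite k A _

theorem exists_eq_smul_of_end_dual (g : Module.End A (A →ₗ[k] k)) : ∃ a : A, ∀ φ, g φ = a • φ := by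
  obtain ⟨a, ha⟩ := (Module.evalEquiv k A).surjective
    (LinearMap.applyₗ (1 : A) ∘ₗ g.restrictScalars k)
  refine ⟨a, fun φ => LinearMap.ext fun x => ?_⟩
  have h : φ (x * a) = g (x • φ) 1 := LinearMap.congr_fun ha (x • φ)
  rw [dual_smul_apply, mul_comm, h, map_smul, dual_smul_apply, mul_one]

theorem eq_zero_of_smul_dual_eq_zero (a : A) (h : ∀ φ : A →ₗ[k] k, a • φ = 0) : a = 0 :=
  (Module.forall_dual_apply_eq_zero_iff k a).mp fun φ => by
    simpa [dual_smul_apply] using LinearMap.congr_fun (h φ) 1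

theorem injective_of_dual_apply_smul_comm [IsLocalRing A]
    (hcomm : ∀ (φ : (A →ₗ[k] k) →ₗ[A] A) (u v : A →ₗ[k] k), φ u • v = φ v • u) :
    Module.Injective A A := by
  have : IsArtinianRing A := IsArtinianRing.of_finite k A
  obtain ⟨e⟩ := nonempty_equiv_of_apply_smul_comm eq_zero_of_smul_dual_eq_zero hcomm
  exact Module.Injective.of_ringEquiv (RingEquiv.refl A) e.symm

end Dual

section Ext

variable {R : Type} [CommRing R]

theorem exists_d_comp_eq_of_isZero_ext {X Y : ModuleCat.{0} R} (P : ProjectiveResolution X)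
    (hext : Limits.IsZero (((Ext R (ModuleCat R) 1).obj (Opposite.op X)).obj Y))
    (h : P.complex.X 1 ⟶ Y) (hh : P.complex.d 2 1 ≫ h = 0) :
    ∃ s : P.complex.X 0 ⟶ Y, P.complex.d 1 0 ≫ s = h := by
  have hz := hext.of_iso (P.isoExt 1 Y).symm
  rw [← HomologicalComplex.exactAt_iff_isZero_homology,
    HomologicalComplex.exactAt_iff' _ 0 1 2 (by simp) (by simp),
    ShortComplex.moduleCat_exact_iff] at hz
  exact hz h hh

/-- If `Ext¹(W, N) = 0`, then maps to `N` extend along kernels of surjections onto `W`. -/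
theorem extendsTo_ker_of_isZero_ext {F W N : Type} [AddCommGroup F] [Module R F]
    [AddCommGroup W] [Module R W] [AddCommGroup N] [Module R N]
    (hext : Limits.IsZero (((Ext R (ModuleCat R) 1).obj
      (Opposite.op (ModuleCat.of R W))).obj (ModuleCat.of R N)))
    {p : F →ₗ[R] W} (hp : Function.Surjective p) : ExtendsTo (LinearMap.ker p) N := by
  intro h
  let P := projectiveResolution (ModuleCat.of R W)
  let d : P.complex.X 1 →ₗ[R] P.complex.X 0 := (P.complex.d 1 0).hom
  let ε : P.complex.X 0 →ₗ[R] W := (P.π.f 0).hom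
  have hεd : ∀ z, ε (d z) = 0 := fun z =>
    LinearMap.congr_fun (congrArg ModuleCat.Hom.hom P.complex_d_comp_π_f_zero) z
  have hexact : ∀ y, ε y = 0 → ∃ z, d z = y :=
    (ShortComplex.moduleCat_exact_iff _).mp P.exact₀
  have : Module.Projective R (P.complex.X 0) :=
    (IsProjective.iff_projective _).mpr (P.projective 0)
  obtain ⟨α, hα⟩ := Module.projective_lifting_property p ε hp
  have hα' : ∀ y, p (α y) = ε y := LinearMap.congr_fun hα
  let β : P.complex.X 1 →ₗ[R] LinearMap.ker p := (α ∘ₗ d).codRestrict _ fun z => by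
    rw [LinearMap.mem_ker, LinearMap.comp_apply, hα', hεd]
  obtain ⟨s, hs⟩ := exists_d_comp_eq_of_isZero_ext P hext (ModuleCat.ofHom (h ∘ₗ β)) (by
    ext z
    have hdd : d ((P.complex.d 2 1).hom z) = 0 :=
      LinearMap.congr_fun (congrArg ModuleCat.Hom.hom (P.complex.d_comp_d 2 1 0)) z
    have : β ((P.complex.d 2 1).hom z) = 0 := Subtype.ext (by simp [β, hdd])
    simp [this])
  have hs' : ∀ z, s.hom (d z) = h (β z) :=
    LinearMap.congr_fun (congrArg ModuleCat.Hom.hom hs)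
  have hε : Function.Surjective ε := (ModuleCat.epi_iff_surjective _).mp inferInstance
  let π : P.complex.X 0 × LinearMap.ker p →ₗ[R] F := α.coprod (LinearMap.ker p).subtype
  have hπ : Function.Surjective π := fun x => by
    obtain ⟨y, hy⟩ := hε (p x)
    exact ⟨(y, ⟨x - α y, by rw [LinearMap.mem_ker, map_sub, hα', hy, sub_self]⟩), by simp [π]⟩
  have hle : LinearMap.ker π ≤ LinearMap.ker (s.hom.coprod h) := by
    rintro ⟨y, κ⟩ hy
    have hy' : α y = -κ.1 := eq_neg_of_add_eq_zero_left (by simpa [π] using hy)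
    obtain ⟨z, rfl⟩ := hexact y (by rw [← hα', hy', map_neg, LinearMap.mem_ker.mp κ.2, neg_zero])
    have hβ : β z = -κ := Subtype.ext hy'
    simp [hs', hβ]
  obtain ⟨H, hH⟩ := exists_comp_eq_of_ker_le hπ hle
  exact ⟨H, LinearMap.ext fun κ => by simpa [π] using LinearMap.congr_fun hH (0, κ)⟩

end Ext

section Descent

variable {Q A : Type} [CommRing Q] [CommRing A] [Algebra Q A]

theorem mem_smul_top_of_mem_ker {F M : Type} [AddCommGroup F] [Module Q F] [AddCommGroup M]
    [Module Q M] {f : List Q} (hM : IsWeaklyRegular M f) {p : F →ₗ[Q] M}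
    (hp : Function.Surjective p) (x : LinearMap.ker p)
    (hx : x.1 ∈ (Ideal.ofList f • ⊤ : Submodule Q F)) :
    x ∈ (Ideal.ofList f • ⊤ : Submodule Q (LinearMap.ker p)) := by
  have hex := map_first_exact_on_four_term_right_exact_of_isSMulRegular_last (rs := f)
    (f₁ := (0 : PUnit →ₗ[Q] LinearMap.ker p)) (f₂ := (LinearMap.ker p).subtype) (f₃ := p)
    (fun y => by simp [eq_comm]) (LinearMap.exact_subtype_ker_map p) hp hM
  rw [← Submodule.Quotient.mk_eq_zero]
  obtain ⟨y, hy⟩ := (hex (Submodule.Quotient.mk x)).mp (by simpa using hx)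
  obtain ⟨y, rfl⟩ := Submodule.Quotient.mk_surjective _ y
  simpa using hy.symm

/-- Lifting problems along a free cover of `M` can be solved in `A = Q / (f)` if they can be solved
along free covers of `M / (f) M` over `A`. -/
theorem extendsTo_ker_of_isWeaklyRegular (hsurj : Function.Surjective (algebraMap Q A))
    {f : List Q} (hker : ∀ q : Q, algebraMap Q A q = 0 ↔ q ∈ Ideal.ofList f)
    {M D : Type} [AddCommGroup M] [Module Q M] [AddCommGroup D] [Module A D] [Module Q D]
    [IsScalarTower Q A D] (hM : IsWeaklyRegular M f)
    (e : (M ⧸ (Ideal.ofList f • ⊤ : Submodule Q M)) ≃ₗ[Q] D)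
    (hD : ∀ (n : ℕ) (g : (Fin n → A) →ₗ[A] D), Function.Surjective g →
      ExtendsTo (LinearMap.ker g) A)
    {n : ℕ} {p : (Fin n → Q) →ₗ[Q] M} (hp : Function.Surjective p) :
    ExtendsTo (LinearMap.ker p) A := by
  intro h
  let c : (Fin n → Q) →ₗ[Q] (Fin n → A) := (Algebra.linearMap Q A).compLeft (Fin n)
  have hc : Function.Surjective c := fun y => by
    choose x hx using fun i => hsurj (y i)
    exact ⟨x, funext hx⟩
  have hckill : ∀ x, c x = 0 ↔ x ∈ (Ideal.ofList f • ⊤ : Submodule Q (Fin n → Q)) := fun x => by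
    rw [mem_smul_top_pi_iff, funext_iff]
    exact forall_congr' fun i => hker (x i)
  have hpI : (Ideal.ofList f • ⊤ : Submodule Q (Fin n → Q)).map p = Ideal.ofList f • ⊤ := by
    rw [map_smul'', Submodule.map_top, LinearMap.range_eq_top.mpr hp]
  let q : (Fin n → Q) →ₗ[Q] D := e.toLinearMap ∘ₗ mkQ _ ∘ₗ p
  have hq : ∀ x, q x = 0 ↔ p x ∈ (Ideal.ofList f • ⊤ : Submodule Q M) := fun x => by simp [q]
  obtain ⟨g, hg⟩ := exists_comp_eq_of_ker_le (g := q) hc fun x hx =>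
    (hq x).mpr (hpI ▸ mem_map_of_mem ((hckill x).mp hx))
  let g' : (Fin n → A) →ₗ[A] D := g.extendScalarsOfSurjective hsurj
  have hgc : ∀ x, g' (c x) = q x := LinearMap.congr_fun hg
  have hg' : Function.Surjective g' := fun w => by
    obtain ⟨x, hx⟩ := (e.surjective.comp ((mkQ_surjective _).comp hp)) w
    exact ⟨c x, (hgc x).trans hx⟩
  have hcmem : ∀ x : LinearMap.ker p, c x ∈ LinearMap.ker g' := fun x => by
    rw [LinearMap.mem_ker, hgc, hq, LinearMap.mem_ker.mp x.2]
    exact zero_mem _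
  let c' : LinearMap.ker p →ₗ[Q] LinearMap.ker g' :=
    { toFun x := ⟨c x, hcmem x⟩
      map_add' x y := Subtype.ext (map_add c x.1 y.1)
      map_smul' a x := Subtype.ext (map_smul c a x.1) }
  have hc' : Function.Surjective c' := by
    rintro ⟨y, hy⟩
    obtain ⟨x, rfl⟩ := hc y
    rw [LinearMap.mem_ker, hgc, hq, ← hpI] at hy
    obtain ⟨z, hz, hzx⟩ := hy
    exact ⟨⟨x - z, by rw [LinearMap.mem_ker, map_sub, hzx, sub_self]⟩, Subtype.ext (by
      change c (x - z) = c x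
      rw [map_sub, (hckill z).mpr hz, sub_zero])⟩
  obtain ⟨h', hh'⟩ := exists_comp_eq_of_ker_le (g := h) hc' fun x hx => by
    have hx' := mem_smul_top_of_mem_ker hM hp x ((hckill x).mp (congrArg Subtype.val hx))
    refine smul_induction_on hx' (fun a ha y _ => ?_) fun y z hy hz => add_mem hy hz
    rw [LinearMap.mem_ker, map_smul, Algebra.smul_def, (hker a).mpr ha, zero_mul]
  obtain ⟨H, hH⟩ := hD n g' hg' (h'.extendScalarsOfSurjective hsurj)
  refine ⟨H.restrictScalars Q ∘ₗ c, LinearMap.ext fun x => ?_⟩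
  exact (LinearMap.congr_fun hH (c' x)).trans (LinearMap.congr_fun hh' x)

end Descent

section Main

variable {k A Q : Type} [Field k] [CommRing A] [Algebra k A] [CommRing Q] [Algebra Q A]
  [Module Q (A →ₗ[k] k)] [IsScalarTower Q A (A →ₗ[k] k)]

/-- The dual of `A` is a direct summand of every `Q`-module containing it on which `Q` acts
through `A`. -/
theorem exists_retraction_dual (hsurj : Function.Surjective (algebraMap Q A)) {X : Type}
    [AddCommGroup X] [Module Q X] (hX : ∀ q : Q, algebraMap Q A q = 0 → ∀ x : X, q • x = 0)
    (i : (A →ₗ[k] k) →ₗ[Q] X) (hi : Function.Injective i) :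
    ∃ ρ : X →ₗ[Q] (A →ₗ[k] k), ∀ w, ρ (i w) = w := by
  let _ : SMul A X := ⟨fun a x => Function.surjInv hsurj a • x⟩
  have hsmul : ∀ (q : Q) (x : X), algebraMap Q A q • x = q • x := fun q x => by
    refine sub_eq_zero.mp ((sub_smul _ _ _).symm.trans (hX _ ?_ x))
    rw [map_sub, Function.surjInv_eq hsurj, sub_self]
  let _ : Module A X := hsurj.moduleLeft (algebraMap Q A) hsmul
  have : IsScalarTower Q A X := .of_algebraMap_smul hsmul
  obtain ⟨ρ, hρ⟩ := Module.Injective.out (i.extendScalarsOfSurjective hsurj) hi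
    (LinearMap.id : (A →ₗ[k] k) →ₗ[A] _)
  exact ⟨ρ.restrictScalars Q, hρ⟩

variable [FiniteDimensional k A] [IsLocalRing Q] [IsNoetherianRing Q]

/-- The dual of `A = Q / (f)` lifts to a finite `Q`-module on which `f` is weakly regular. -/
theorem exists_lift_dual [IsLocalRing A] [IsAdicComplete (maximalIdeal Q) Q]
    (hsurj : Function.Surjective (algebraMap Q A)) {f : List Q}
    (hker : ∀ q : Q, algebraMap Q A q = 0 ↔ q ∈ Ideal.ofList f)
    (hreg : IsWeaklyRegular Q f) (hm : ∀ r ∈ f, r ∈ maximalIdeal Q) :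
    ∃ (M : Type) (_ : AddCommGroup M) (_ : Module Q M), Module.Finite Q M ∧ IsWeaklyRegular M f ∧
      Nonempty ((M ⧸ (Ideal.ofList f • ⊤ : Submodule Q M)) ≃ₗ[Q] (A →ₗ[k] k)) := by
  have hkill : ∀ r ∈ f, algebraMap Q A r = 0 := fun r hr => (hker r).mpr (Ideal.subset_span hr)
  obtain ⟨E, _, _, _, ⟨e⟩⟩ := exists_injective_killedBy_equiv f (A →ₗ[k] k)
    (fun r hr w => by rw [← algebraMap_smul A, hkill r hr, zero_smul])
    (fun X _ _ hX i hi => by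
      have hann : ∀ q : Q, algebraMap Q A q = 0 → ∀ x : X, q • x = 0 := fun q hq =>
        Module.mem_annihilator.mp (Ideal.span_le.mpr
          (fun r hr => Module.mem_annihilator.mpr (hX r hr)) ((hker q).mp hq))
      exact exists_retraction_dual hsurj hann i hi)
  have hco := isCoregular_of_injective (N := E) f [] hreg
  obtain ⟨M, _, _, f', hperm, hM, ⟨e'⟩, hsep⟩ := exists_isWeaklyRegular_of_isCoregular f E _ hco
  have e'' := e' ≪≫ₗ e
  have : Module.Finite Q A := Module.Finite.of_surjective (Algebra.linearMap Q A) hsurj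
  have : Module.Finite Q (A →ₗ[k] k) := Module.Finite.trans A _
  have : Module.Finite Q (M ⧸ (Ideal.ofList f • ⊤ : Submodule Q M)) := Module.Finite.equiv e''.symm
  have hrad : maximalIdeal Q ≤ (Ideal.ofList f).radical := fun x hx => by
    have : IsArtinianRing A := IsArtinianRing.of_finite k A
    have : IsLocalHom (algebraMap Q A) := hsurj.isLocalHom _
    obtain ⟨n, hn⟩ := (isArtinianRing_iff_isNilpotent_maximalIdeal A).mp inferInstance
    refine ⟨n, (hker _).mp ?_⟩
    rw [map_pow]
    have := Ideal.pow_mem_pow (map_nonunit (algebraMap Q A) x hx) n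
    rwa [hn] at this
  have : Module.Finite Q M := finite_of_finite_quotient f hm hrad hsep
  exact ⟨M, inferInstance, inferInstance, this,
    isWeaklyRegular_of_perm_of_subset_maximalIdeal hM hperm fun r hr => hm r (hperm.mem_iff.mp hr),
    ⟨e''⟩⟩

/-- Linear forms on the dual of `A = Q / (f)` lift to the module `M` over the reduced ring `Q`, and
hence satisfy `φ u • v = φ v • u`. -/
theorem dual_apply_smul_comm [IsReduced Q]
    (hsurj : Function.Surjective (algebraMap Q A)) {f : List Q}
    (hker : ∀ q : Q, algebraMap Q A q = 0 ↔ q ∈ Ideal.ofList f)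
    (hreg : IsWeaklyRegular Q f) (hm : ∀ r ∈ f, r ∈ maximalIdeal Q)
    {M : Type} [AddCommGroup M] [Module Q M] [Module.Finite Q M] (hM : IsWeaklyRegular M f)
    (e : (M ⧸ (Ideal.ofList f • ⊤ : Submodule Q M)) ≃ₗ[Q] (A →ₗ[k] k))
    (hD : ∀ (n : ℕ) (g : (Fin n → A) →ₗ[A] (A →ₗ[k] k)), Function.Surjective g →
      ExtendsTo (LinearMap.ker g) A)
    (φ : (A →ₗ[k] k) →ₗ[A] A) (u v : A →ₗ[k] k) : φ u • v = φ v • u := by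
  obtain ⟨n, p, hp⟩ := Module.Finite.exists_fin' Q M
  have hkerA : (Ideal.ofList f • ⊤ : Submodule Q Q) = LinearMap.ker (Algebra.linearMap Q A) := by
    ext q
    simp [hker]
  let eA : (Q ⧸ (Ideal.ofList f • ⊤ : Submodule Q Q)) ≃ₗ[Q] A :=
    quotEquivOfEq _ _ hkerA ≪≫ₗ (Algebra.linearMap Q A).quotKerEquivOfSurjective hsurj
  have hlift := (ExtendsTo.of_isWeaklyRegular hp f hm Q hreg
    ((extendsTo_ker_of_isWeaklyRegular hsurj hker hM e hD hp).congr eA.symm)).2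
  have hend := exists_eq_smul_of_isWeaklyRegular f hm M hM fun g => by
    obtain ⟨a, ha⟩ := exists_eq_smul_of_end_dual
      ((e.toLinearMap ∘ₗ g ∘ₗ e.symm.toLinearMap).extendScalarsOfSurjective hsurj)
    obtain ⟨a, rfl⟩ := hsurj a
    exact ⟨a, fun x => e.injective (by simpa using ha (e x))⟩
  have hfaith : ∀ a : Q, (∀ x : M, a • x = 0) → a = 0 := fun a ha =>
    mem_of_smul_eq_zero_of_isWeaklyRegular f hm M ⊥ hM (by simp) (fun b hb => by
      rw [bot_sup_eq, ← hker]
      refine eq_zero_of_smul_dual_eq_zero (k := k) _ fun w => ?_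
      rw [algebraMap_smul]
      simpa using congrArg e (hb (e.symm w))) a ha
  obtain ⟨Φ, hΦ⟩ := hlift (eA.symm.toLinearMap ∘ₗ φ.restrictScalars Q ∘ₗ e.toLinearMap ∘ₗ mkQ _)
  have hΦ' : ∀ x : M, φ (e (Submodule.Quotient.mk x)) = algebraMap Q A (Φ x) := fun x => by
    have := congrArg eA (LinearMap.congr_fun hΦ x)
    exact (eA.apply_symm_apply _).symm.trans this.symm
  obtain ⟨u, rfl⟩ := (e.surjective.comp (mkQ_surjective _)) u
  obtain ⟨v, rfl⟩ := (e.surjective.comp (mkQ_surjective _)) v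
  simp only [Function.comp_apply, mkQ_apply, hΦ', algebraMap_smul, ← map_smul,
    ← Submodule.Quotient.mk_smul]
  rw [apply_smul_comm_of_isReduced hend hfaith]

end Main

end DualizingLift

/-- Let `A` be a commutative local algebra of finite rank over a field
`k` (with residue field `k`) such that `A ≅ Q/(f)` with `Q` a reduced complete noetherian
local ring and `f` a `Q`-regular sequence contained in the maximal ideal.  If
`Ext^1_A(Hom_k(A, k), A) = 0`, then `A` is selfinjective. -/
theorem selfinjective_of_quotient_of_reduced_complete_of_ext_one_vanishes
    (k A : Type) [Field k] [CommRing A] [Algebra k A] [FiniteDimensional k A]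
    [IsLocalRing A]
    (hres : Function.Bijective (algebraMap k (A ⧸ IsLocalRing.maximalIdeal A)))
    (hpres : ∃ (Q : Type) (iQ : CommRing Q),
      letI := iQ
      ∃ (_ : IsNoetherianRing Q) (lQ : IsLocalRing Q),
        letI := lQ
        IsReduced Q ∧ IsAdicComplete (IsLocalRing.maximalIdeal Q) Q ∧
        ∃ f : List Q, RingTheory.Sequence.IsRegular Q f ∧
          (∀ x ∈ f, x ∈ IsLocalRing.maximalIdeal Q) ∧
          Nonempty (A ≃+* Q ⧸ Ideal.ofList f))
    (hext : Limits.IsZero (((Ext A (ModuleCat A) 1).obj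
      (Opposite.op (ModuleCat.of A (A →ₗ[k] k)))).obj (ModuleCat.of A A))) :
    Module.Injective A A := by
  obtain ⟨Q, _, _, _, _, _, f, hreg, hm, ⟨e⟩⟩ := hpres
  let _ : Algebra Q A := (e.symm.toRingHom.comp (Ideal.Quotient.mk (Ideal.ofList f))).toAlgebra
  have hsurj : Function.Surjective (algebraMap Q A) :=
    e.symm.surjective.comp Ideal.Quotient.mk_surjective
  have hker : ∀ q : Q, algebraMap Q A q = 0 ↔ q ∈ Ideal.ofList f := fun q => by
    rw [← Ideal.Quotient.eq_zero_iff_mem]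
    exact map_eq_zero_iff e.symm e.symm.injective
  let _ : Module Q (A →ₗ[k] k) := Module.compHom _ (algebraMap Q A)
  have : IsScalarTower Q A (A →ₗ[k] k) := .of_algebraMap_smul fun _ _ => rfl
  obtain ⟨M, _, _, _, hM, ⟨eM⟩⟩ :=
    DualizingLift.exists_lift_dual (k := k) hsurj hker hreg.toIsWeaklyRegular hm
  exact DualizingLift.injective_of_dual_apply_smul_comm
    (DualizingLift.dual_apply_smul_comm hsurj hker hreg.toIsWeaklyRegular hm hM eM
      fun _ _ hg => DualizingLift.extendsTo_ker_of_isZero_ext hext hg)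
end
end
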